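/- arXiv:2405.12828 — 2 statements merged into one kernel-verified Lean document; each statement's English description precedes it below -/
import Mathlib

section
/- Let ω be a (p,q) double form on an n-dimensional Euclidean space and k ≥ 1 with p + q + k < n + 1. If gᵏ·ω = 0 (exterior product with the k-th power of the metric) then ω = 0. -/
noncomputable section

open Finset
open scoped RealInnerProductSpace

/-- Euclidean `n`-space. -/
abbrev Evec (n : ℕ) := EuclideanSpace ℝ (Fin n)

/-- The space of `(p,q)` double forms, modeled as real-valued kernels on pairs of tuples. -/
abbrev DF (n p q : ℕ) := (Fin p → Evec n) → (Fin q → Evec n) → ℝ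

/-- `p`-forms. -/
abbrev Form (n p : ℕ) := (Fin p → Evec n) → ℝ

/-- Mixed-degree forms (elements of the full exterior algebra). -/
abbrev MixedForm (n : ℕ) := ∀ p, Form n p

/-- Mixed-bidegree double forms. -/
abbrev MixedDF (n : ℕ) := ∀ p q, DF n p q

/-- The standard orthonormal basis. -/
def ebasis (n : ℕ) (i : Fin n) : Evec n := EuclideanSpace.single i 1

/-- The metric as a `(1,1)` double form. -/
def gdf (n : ℕ) : DF n 1 1 := fun x y => ⟪x 0, y 0⟫

/-- Alternating multilinear predicate for a `p`-form kernel. -/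
def IsAltML {n m : ℕ} (f : Form n m) : Prop :=
  (∀ (x : Fin m → Evec n) (i : Fin m) (c : ℝ) (a b : Evec n),
      f (Function.update x i (c • a + b)) =
        c * f (Function.update x i a) + f (Function.update x i b)) ∧
  (∀ (x : Fin m → Evec n) (i j : Fin m), i ≠ j → x i = x j → f x = 0)

/-- A kernel is a genuine double form iff it is alternating multilinear in both blocks. -/
def IsDF {n p q : ℕ} (ω : DF n p q) : Prop :=
  (∀ y, IsAltML (n := n) fun x => ω x y) ∧ (∀ x, IsAltML (ω x))

/-- Bilinearity of a function of two vectors. -/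
def IsBilin {n : ℕ} (h : Evec n → Evec n → ℝ) : Prop :=
  (∀ y, IsLinearMap ℝ fun x => h x y) ∧ (∀ x, IsLinearMap ℝ (h x))

/-- A 2-form: an alternating bilinear function. -/
def IsAltBilin {n : ℕ} (h : Evec n → Evec n → ℝ) : Prop :=
  IsBilin h ∧ ∀ x, h x x = 0

/-- Exterior product of double forms. -/
def wedge {n p q r s : ℕ} (ω : DF n p q) (η : DF n r s) : DF n (p + r) (q + s) :=
  fun x y =>
    (((p.factorial * r.factorial * q.factorial * s.factorial : ℕ) : ℝ))⁻¹ *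
      ∑ σ : Equiv.Perm (Fin (p + r)), ∑ τ : Equiv.Perm (Fin (q + s)),
        ((Equiv.Perm.sign σ : ℤ) : ℝ) * ((Equiv.Perm.sign τ : ℤ) : ℝ) *
          ω (fun i => x (σ (Fin.castAdd r i))) (fun j => y (τ (Fin.castAdd s j))) *
          η (fun i => x (σ (Fin.natAdd p i))) (fun j => y (τ (Fin.natAdd q j)))

/-- Exterior powers of the metric: `gᵖ`. -/
def gpow (n : ℕ) : (p : ℕ) → DF n p p
  | 0 => fun _ _ => 1
  | p + 1 => wedge (gpow n p) (gdf n)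

/-- The natural inner product of `(p,q)` double forms. -/
def innerDF {n p q : ℕ} (ω η : DF n p q) : ℝ :=
  (((p.factorial * q.factorial : ℕ) : ℝ))⁻¹ *
    ∑ f : Fin p → Fin n, ∑ h : Fin q → Fin n,
      ω (fun i => ebasis n (f i)) (fun j => ebasis n (h j)) *
        η (fun i => ebasis n (f i)) (fun j => ebasis n (h j))

/-- Composition product of double forms: `comp ω₁ ω₂ = ω₁ ∘ ω₂`. -/
def comp {n p q r : ℕ} (ω₁ : DF n p q) (ω₂ : DF n r p) : DF n r q :=
  fun x y =>
    ((p.factorial : ℝ))⁻¹ *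
      ∑ f : Fin p → Fin n,
        ω₂ x (fun i => ebasis n (f i)) * ω₁ (fun i => ebasis n (f i)) y

/-- Transpose of a double form. -/
def transp {n p q : ℕ} (ω : DF n p q) : DF n q p := fun x y => ω y x

/-- Inclusion of bilinear forms as `(1,1)` double forms (the map `ρ`). -/
def rho {n : ℕ} (h : Evec n → Evec n → ℝ) : DF n 1 1 := fun x y => h (x 0) (y 0)

/-- Inner product of 2-forms. -/
def inner2 {n : ℕ} (α β : Evec n → Evec n → ℝ) : ℝ :=
  (2:ℝ)⁻¹ * ∑ i, ∑ j, α (ebasis n i) (ebasis n j) * β (ebasis n i) (ebasis n j)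

/-- The curvature operator of a `(2,2)` double form, acting on 2-forms. -/
def curvOp {n : ℕ} (R : DF n 2 2) (θ : Evec n → Evec n → ℝ) : Evec n → Evec n → ℝ :=
  fun x y => (2:ℝ)⁻¹ * ∑ i, ∑ j,
    θ (ebasis n i) (ebasis n j) * R ![ebasis n i, ebasis n j] ![x, y]

/-- The first Bianchi identity for a `(2,2)` double form. -/
def FirstBianchi {n : ℕ} (R : DF n 2 2) : Prop :=
  ∀ x y z t : Evec n, R ![x, y] ![z, t] + R ![y, z] ![x, t] + R ![z, x] ![y, t] = 0

/-- The Ricci contraction `c R` of a `(2,2)` double form. -/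
def ricci {n : ℕ} (R : DF n 2 2) : DF n 1 1 :=
  fun x y => ∑ i, R ![ebasis n i, x 0] ![ebasis n i, y 0]

/-- Contraction of double forms. -/
def contr {n p q : ℕ} (ω : DF n (p + 1) (q + 1)) : DF n p q :=
  fun x y => ∑ i, ω (Fin.cons (ebasis n i) x) (Fin.cons (ebasis n i) y)

/-- Iterated contraction `cʳ`. -/
def contrIter {n : ℕ} : (r : ℕ) → {p q : ℕ} → DF n (p + r) (q + r) → DF n p q
  | 0, _, _, ω => ω
  | r + 1, _, _, ω => contrIter r (contr ω)

/-- The `(1,1)` double form associated to an endomorphism. -/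
def hdf {n : ℕ} (h : Evec n →ₗ[ℝ] Evec n) : DF n 1 1 := fun x y => ⟪h (x 0), y 0⟫

/-- Left exterior multiplication of a form by a covector `f`. -/
def wedgeC {n p : ℕ} (f : Evec n → ℝ) (α : Form n p) : Form n (p + 1) :=
  fun x => ∑ i : Fin (p + 1), (-1 : ℝ) ^ (i : ℕ) * f (x i) * α (x ∘ i.succAbove)

/-- Interior product of a form by a vector. -/
def iotaV {n : ℕ} : {p : ℕ} → Evec n → Form n p → Form n (p - 1)
  | 0, _, _ => 0
  | _ + 1, v, α => fun x => α (Fin.cons v x)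


/-- Interior product (non-truncating version). -/
def iotaV' {n p : ℕ} (v : Evec n) (α : Form n (p + 1)) : Form n p :=
  fun x => α (Fin.cons v x)

/-- Interior product in the first block (non-truncating version). -/
def iotaL' {n p q : ℕ} (v : Evec n) (ω : DF n (p + 1) q) : DF n p q :=
  fun x y => ω (Fin.cons v x) y

/-- Interior product in the second block (non-truncating version). -/
def iotaR' {n p q : ℕ} (v : Evec n) (ω : DF n p (q + 1)) : DF n p q :=
  fun x y => ω x (Fin.cons v y)

/-- Embedding a homogeneous form into mixed forms. -/
def embF {n : ℕ} (p : ℕ) (α : Form n p) : MixedForm n :=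
  fun d => if h : d = p then cast (show Form n p = Form n d by rw [h]) α else 0

/-- Left Clifford multiplication `v · α` of a homogeneous form. -/
def cliffLone {n p : ℕ} (v : Evec n) (α : Form n p) : MixedForm n :=
  embF (p + 1) (wedgeC (fun u => ⟪v, u⟫) α) - embF (p - 1) (iotaV v α)

/-- Right Clifford multiplication `α · v` of a homogeneous form. -/
def cliffRone {n p : ℕ} (v : Evec n) (α : Form n p) : MixedForm n :=
  (-1 : ℝ) ^ p • (embF (p + 1) (wedgeC (fun u => ⟪v, u⟫) α) + embF (p - 1) (iotaV v α))

/-- Left Clifford multiplication by a vector on mixed forms. -/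
def cliffLv {n : ℕ} (v : Evec n) (ω : MixedForm n) : MixedForm n :=
  fun d => match d with
  | 0 => -(iotaV' v (ω 1))
  | d + 1 => wedgeC (fun u => ⟪v, u⟫) (ω d) - iotaV' v (ω (d + 1 + 1))

/-- Right Clifford multiplication by a vector on mixed forms. -/
def cliffRv {n : ℕ} (v : Evec n) (ω : MixedForm n) : MixedForm n :=
  fun d => match d with
  | 0 => -(iotaV' v (ω 1))
  | d + 1 => (-1 : ℝ) ^ d • (wedgeC (fun u => ⟪v, u⟫) (ω d) + iotaV' v (ω (d + 1 + 1)))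

/-- Left Clifford multiplication by a 2-form on mixed forms. -/
def cliffL2 {n : ℕ} (α : Evec n → Evec n → ℝ) (ω : MixedForm n) : MixedForm n :=
  (2:ℝ)⁻¹ • ∑ i, ∑ j, α (ebasis n i) (ebasis n j) • cliffLv (ebasis n i) (cliffLv (ebasis n j) ω)

/-- Right Clifford multiplication by a 2-form on mixed forms. -/
def cliffR2 {n : ℕ} (α : Evec n → Evec n → ℝ) (ω : MixedForm n) : MixedForm n :=
  (2:ℝ)⁻¹ • ∑ i, ∑ j, α (ebasis n i) (ebasis n j) • cliffRv (ebasis n j) (cliffRv (ebasis n i) ω)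

/-- Interior product by a vector in the first block of a double form. -/
def iotaL {n : ℕ} : {p q : ℕ} → Evec n → DF n p q → DF n (p - 1) q
  | 0, _, _, _ => 0
  | _ + 1, _, v, ω => fun x y => ω (Fin.cons v x) y

/-- Interior product by a vector in the second block of a double form. -/
def iotaR {n : ℕ} : {p q : ℕ} → Evec n → DF n p q → DF n p (q - 1)
  | _, 0, _, _ => 0
  | _, _ + 1, v, ω => fun x y => ω x (Fin.cons v y)

/-- Exterior multiplication by a covector in the first block. -/
def wedgeCL {n p q : ℕ} (f : Evec n → ℝ) (ω : DF n p q) : DF n (p + 1) q :=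
  fun x y => ∑ i : Fin (p + 1), (-1 : ℝ) ^ (i : ℕ) * f (x i) * ω (x ∘ i.succAbove) y

/-- Exterior multiplication by a covector in the second block. -/
def wedgeCR {n p q : ℕ} (f : Evec n → ℝ) (ω : DF n p q) : DF n p (q + 1) :=
  fun x y => ∑ j : Fin (q + 1), (-1 : ℝ) ^ (j : ℕ) * f (y j) * ω x (y ∘ j.succAbove)

/-- Left Clifford multiplication by a vector on the first factor of mixed double forms. -/
def cliffLvL {n : ℕ} (v : Evec n) (Ω : MixedDF n) : MixedDF n :=
  fun p q => match p with
  | 0 => -(iotaL' v (Ω 1 q))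
  | p + 1 => wedgeCL (fun u => ⟪v, u⟫) (Ω p q) - iotaL' v (Ω (p + 1 + 1) q)

/-- Right Clifford multiplication by a vector on the first factor of mixed double forms. -/
def cliffRvL {n : ℕ} (v : Evec n) (Ω : MixedDF n) : MixedDF n :=
  fun p q => match p with
  | 0 => -(iotaL' v (Ω 1 q))
  | p + 1 => (-1 : ℝ) ^ p • (wedgeCL (fun u => ⟪v, u⟫) (Ω p q) + iotaL' v (Ω (p + 1 + 1) q))

/-- Left Clifford multiplication by a vector on the second factor of mixed double forms. -/
def cliffLvR {n : ℕ} (v : Evec n) (Ω : MixedDF n) : MixedDF n :=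
  fun p q => match q with
  | 0 => -(iotaR' v (Ω p 1))
  | q + 1 => wedgeCR (fun u => ⟪v, u⟫) (Ω p q) - iotaR' v (Ω p (q + 1 + 1))

/-- Right Clifford multiplication by a vector on the second factor of mixed double forms. -/
def cliffRvR {n : ℕ} (v : Evec n) (Ω : MixedDF n) : MixedDF n :=
  fun p q => match q with
  | 0 => -(iotaR' v (Ω p 1))
  | q + 1 => (-1 : ℝ) ^ q • (wedgeCR (fun u => ⟪v, u⟫) (Ω p q) + iotaR' v (Ω p (q + 1 + 1)))

/-- Clifford commutator with a covector (1-form) on the first factor. -/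
def adLone {n : ℕ} (v : Evec n) (Ω : MixedDF n) : MixedDF n :=
  cliffLvL v Ω - cliffRvL v Ω

/-- Clifford commutator with a covector (1-form) on the second factor. -/
def adRone {n : ℕ} (v : Evec n) (Ω : MixedDF n) : MixedDF n :=
  cliffLvR v Ω - cliffRvR v Ω

/-- The sharp product of a `(1,1)` double form with a mixed double form. -/
def sharp11 {n : ℕ} (h : Evec n → Evec n → ℝ) (Ω : MixedDF n) : MixedDF n :=
  ∑ i, ∑ j, h (ebasis n i) (ebasis n j) • adLone (ebasis n i) (adRone (ebasis n j) Ω)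

/-- Clifford commutator with the 2-form `v ∧ w` (for orthonormal `v, w`) on the first factor. -/
def adLpair {n : ℕ} (v w : Evec n) (Ω : MixedDF n) : MixedDF n :=
  cliffLvL v (cliffLvL w Ω) - cliffRvL w (cliffRvL v Ω)

/-- Clifford commutator with the 2-form `v ∧ w` (for orthonormal `v, w`) on the second factor. -/
def adRpair {n : ℕ} (v w : Evec n) (Ω : MixedDF n) : MixedDF n :=
  cliffLvR v (cliffLvR w Ω) - cliffRvR w (cliffRvR v Ω)

/-- Clifford commutator with a 2-form on the first factor. -/
def adL2 {n : ℕ} (α : Evec n → Evec n → ℝ) (Ω : MixedDF n) : MixedDF n :=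
  (2:ℝ)⁻¹ • ∑ i, ∑ j, α (ebasis n i) (ebasis n j) • adLpair (ebasis n i) (ebasis n j) Ω

/-- Clifford commutator with a 2-form on the second factor. -/
def adR2 {n : ℕ} (α : Evec n → Evec n → ℝ) (Ω : MixedDF n) : MixedDF n :=
  (2:ℝ)⁻¹ • ∑ i, ∑ j, α (ebasis n i) (ebasis n j) • adRpair (ebasis n i) (ebasis n j) Ω

/-- The sharp product of a `(2,2)` double form with a mixed double form. -/
def sharpR {n : ℕ} (R : DF n 2 2) (Ω : MixedDF n) : MixedDF n :=
  (4:ℝ)⁻¹ • ∑ i, ∑ j, ∑ k, ∑ l,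
    R ![ebasis n i, ebasis n j] ![ebasis n k, ebasis n l] •
      adLpair (ebasis n i) (ebasis n j) (adRpair (ebasis n k) (ebasis n l) Ω)

/-- Embedding of a homogeneous double form into mixed double forms. -/
def embDF {n : ℕ} (p q : ℕ) (ω : DF n p q) : MixedDF n :=
  fun p' q' =>
    if h : p' = p ∧ q' = q then cast (show DF n p q = DF n p' q' by rw [h.1, h.2]) ω else 0

/-- Interior product of a double form by a `(1,1)` double form. -/
def iotaH {n : ℕ} : {p q : ℕ} → (Evec n → Evec n → ℝ) → DF n p q → DF n (p - 1) (q - 1)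
  | 0, _, _, _ => 0
  | _ + 1, 0, _, _ => 0
  | _ + 1, _ + 1, h, ω => fun x y =>
      ∑ i, ∑ j, h (ebasis n i) (ebasis n j) *
        ω (Fin.cons (ebasis n i) x) (Fin.cons (ebasis n j) y)

/-- Contraction of a double form, defined in every bidegree. -/
def contrAny {n : ℕ} : {p q : ℕ} → DF n p q → DF n (p - 1) (q - 1)
  | 0, _, _ => 0
  | _ + 1, 0, _ => 0
  | _ + 1, _ + 1, ω => fun x y =>
      ∑ i, ω (Fin.cons (ebasis n i) x) (Fin.cons (ebasis n i) y)

/-- The first Bianchi sum `𝔖`. -/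
def bianchiT {n : ℕ} : {p q : ℕ} → DF n p q → DF n (p + 1) (q - 1)
  | _, 0, _ => 0
  | p, _ + 1, ω => fun x y =>
      ∑ i, ∑ a : Fin (p + 1), (-1 : ℝ) ^ (a : ℕ) * ⟪ebasis n i, x a⟫ *
        ω (x ∘ a.succAbove) (Fin.cons (ebasis n i) y)

/-- The adjoint first Bianchi sum `𝔖̃`. -/
def bianchiAdjT {n : ℕ} : {p q : ℕ} → DF n p q → DF n (p - 1) (q + 1)
  | 0, _, _ => 0
  | _ + 1, q, ω => fun x y =>
      ∑ i, ∑ b : Fin (q + 1), (-1 : ℝ) ^ (b : ℕ) * ⟪ebasis n i, y b⟫ *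
        ω (Fin.cons (ebasis n i) x) (y ∘ b.succAbove)

/-- `g^{q-1} ρ(α) / (q-1)!`, the derivation extension of a `(1,1)` double form, with the
convention that it vanishes for `q = 0` (i.e. `g⁻¹ = 0`). -/
def gPowRho {n : ℕ} : (q : ℕ) → (Evec n → Evec n → ℝ) → DF n q q
  | 0, _ => 0
  | q + 1, α => ((q.factorial : ℝ))⁻¹ • wedge (gpow n q) (rho α)

/-- A 2-form is expressible in terms of `m` covectors. -/
def ExprBy {n : ℕ} (E : Evec n → Evec n → ℝ) (m : ℕ) : Prop :=
  ∃ (w : Fin m → Evec n) (c : Fin m → Fin m → ℝ), ∀ x y,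
    E x y = ∑ a, ∑ b, c a b * (⟪w a, x⟫ * ⟪w b, y⟫ - ⟪w a, y⟫ * ⟪w b, x⟫)

/-! ### Helper material -/

/-- Exterior multiplication by the metric, in expanded form. -/
def gUp {n p q : ℕ} (ω : DF n p q) : DF n (p + 1) (q + 1) := fun x y =>
  ∑ a : Fin (p + 1), ∑ b : Fin (q + 1), (-1 : ℝ) ^ (a : ℕ) * (-1 : ℝ) ^ (b : ℕ) *
    ⟪x a, y b⟫ * ω (x ∘ a.succAbove) (y ∘ b.succAbove)

/-- `gUp` on mixed double forms. -/
def gUpM {n : ℕ} (Ω : MixedDF n) : MixedDF n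
  | p + 1, q + 1 => gUp (Ω p q)
  | 0, _ => 0
  | _ + 1, 0 => 0

/-- Contraction on mixed double forms. -/
def contrM {n : ℕ} (Ω : MixedDF n) : MixedDF n := fun p q => contr (Ω (p + 1) (q + 1))

/-- Iterates of `gUpM`. -/
def gIt {n : ℕ} : ℕ → MixedDF n → MixedDF n
  | 0, Ω => Ω
  | k + 1, Ω => gUpM (gIt k Ω)

/-- All components are genuine double forms. -/
def IsMDF {n : ℕ} (Ω : MixedDF n) : Prop := ∀ p q, IsDF (Ω p q)

theorem isAltML_iff {n m : ℕ} (f : Form n m) :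
    IsAltML f ↔ ∃ F : (Evec n) [⋀^Fin m]→ₗ[ℝ] ℝ, ∀ x, F x = f x := by
  constructor
  · rintro ⟨h1, h2⟩
    have hz : ∀ (x : Fin m → Evec n) (i : Fin m), f (Function.update x i 0) = 0 := by
      intro x i
      have := h1 x i 1 0 0
      simp only [smul_zero, add_zero, one_mul] at this
      linarith
    refine ⟨{ toFun := f, map_update_add' := ?_, map_update_smul' := ?_,
              map_eq_zero_of_eq' := ?_ }, fun x => rfl⟩
    · intro inst x i a b
      have e : inst = instDecidableEqFin m := Subsingleton.elim _ _
      subst e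
      have := h1 x i 1 a b
      simpa using this
    · intro inst x i c a
      have e : inst = instDecidableEqFin m := Subsingleton.elim _ _
      subst e
      have := h1 x i c a 0
      rw [hz, add_zero, add_zero] at this
      simpa using this
    · intro x i j hij hne
      exact h2 x i j hne hij
  · rintro ⟨F, hF⟩
    refine ⟨fun x i c a b => ?_, fun x i j hne hij => ?_⟩
    · rw [← hF, ← hF, ← hF, F.map_update_add, F.map_update_smul, smul_eq_mul]
    · rw [← hF]; exact F.map_eq_zero_of_eq x hij hne

theorem IsAltML.perm {n m : ℕ} {f : Form n m} (hf : IsAltML f) (x : Fin m → Evec n)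
    (σ : Equiv.Perm (Fin m)) :
    f (fun i => x (σ i)) = ((Equiv.Perm.sign σ : ℤ) : ℝ) * f x := by
  obtain ⟨F, hF⟩ := (isAltML_iff f).1 hf
  have := F.map_perm x σ
  rw [← hF, ← hF]
  have e : (fun i => x (σ i)) = x ∘ σ := rfl
  rw [e, this]
  rcases Int.units_eq_one_or (Equiv.Perm.sign σ) with h | h <;> simp [h]

theorem IsAltML.zero {n m : ℕ} : IsAltML (n := n) (m := m) (fun _ => 0) :=
  ⟨by intros; simp, by intros; rfl⟩

theorem IsAltML.sum {n m : ℕ} {ι : Type*} (s : Finset ι) {f : ι → Form n m}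
    (h : ∀ i, IsAltML (f i)) : IsAltML (fun x => ∑ i ∈ s, f i x) := by
  refine ⟨fun x i c a b => ?_, fun x i j hne hij => ?_⟩
  · rw [Finset.mul_sum, ← Finset.sum_add_distrib]
    exact Finset.sum_congr rfl fun t _ => (h t).1 x i c a b
  · exact Finset.sum_eq_zero fun t _ => (h t).2 x i j hne hij

theorem IsAltML.const_mul {n m : ℕ} (r : ℝ) {f : Form n m}
    (h : IsAltML f) : IsAltML (fun x => r * f x) := by
  refine ⟨fun x i c a b => ?_, fun x i j hne hij => ?_⟩
  · simp only [h.1 x i c a b]; ring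
  · simp only [h.2 x i j hne hij, mul_zero]

theorem IsAltML.wedgeL {n m : ℕ} {f : Form n m} (h : IsAltML f) (φ : Evec n →ₗ[ℝ] ℝ) :
    IsAltML (fun x : Fin (m + 1) → Evec n =>
      ∑ a : Fin (m + 1), (-1 : ℝ) ^ (a : ℕ) * (φ (x a) * f (x ∘ a.succAbove))) := by
  obtain ⟨F, hF⟩ := (isAltML_iff f).1 h
  rw [isAltML_iff]
  refine ⟨AlternatingMap.alternatizeUncurryFin (φ.smulRight F), fun x => ?_⟩
  rw [AlternatingMap.alternatizeUncurryFin_apply]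
  refine Finset.sum_congr rfl fun a _ => ?_
  have e : a.removeNth x = x ∘ a.succAbove := rfl
  simp [e, hF]

theorem IsAltML.consL {n m : ℕ} {f : Form n (m + 1)} (h : IsAltML f) (v : Evec n) :
    IsAltML (fun x : Fin m → Evec n => f (Fin.cons v x)) := by
  refine ⟨fun x i c a b => ?_, fun x i j hne hij => ?_⟩
  · simp only [Fin.cons_update]; exact h.1 _ _ c a b
  · refine h.2 _ i.succ j.succ ?_ ?_
    · simpa using hne
    · simpa using hij

theorem gUp_isDF {n p q : ℕ} {ω : DF n p q} (h : IsDF ω) : IsDF (gUp ω) := by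
  constructor
  · intro y
    have : (fun x => gUp ω x y) = fun x => ∑ b : Fin (q + 1), (-1 : ℝ) ^ (b : ℕ) *
        ∑ a : Fin (p + 1), (-1 : ℝ) ^ (a : ℕ) *
          ((innerₛₗ ℝ (y b)) (x a) * ω (x ∘ a.succAbove) (y ∘ b.succAbove)) := by
      funext x
      unfold gUp
      rw [Finset.sum_comm]
      refine Finset.sum_congr rfl fun b _ => ?_
      rw [Finset.mul_sum]
      refine Finset.sum_congr rfl fun a _ => ?_
      rw [innerₛₗ_apply_apply, real_inner_comm]; ring
    rw [this]
    exact IsAltML.sum _ fun b => ((h.1 _).wedgeL _).const_mul _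
  · intro x
    have : gUp ω x = fun y => ∑ a : Fin (p + 1), (-1 : ℝ) ^ (a : ℕ) *
        ∑ b : Fin (q + 1), (-1 : ℝ) ^ (b : ℕ) *
          ((innerₛₗ ℝ (x a)) (y b) * ω (x ∘ a.succAbove) (y ∘ b.succAbove)) := by
      funext y
      unfold gUp
      refine Finset.sum_congr rfl fun b _ => ?_
      rw [Finset.mul_sum]
      refine Finset.sum_congr rfl fun a _ => ?_
      rw [innerₛₗ_apply_apply]; ring
    rw [this]
    exact IsAltML.sum _ fun b => ((h.2 _).wedgeL _).const_mul _

theorem contr_isDF {n p q : ℕ} {ω : DF n (p + 1) (q + 1)} (h : IsDF ω) : IsDF (contr ω) :=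
  ⟨fun y => IsAltML.sum _ fun i => (h.1 (Fin.cons (ebasis n i) y)).consL (ebasis n i),
   fun x => IsAltML.sum _ fun i => (h.2 (Fin.cons (ebasis n i) x)).consL (ebasis n i)⟩

theorem zero_isDF {n p q : ℕ} : IsDF (0 : DF n p q) :=
  ⟨fun _ => IsAltML.zero, fun _ => IsAltML.zero⟩

theorem gUpM_isMDF {n : ℕ} {Ω : MixedDF n} (h : IsMDF Ω) : IsMDF (gUpM Ω) := by
  intro p q
  cases p with
  | zero => exact zero_isDF
  | succ p =>
    cases q with
    | zero => exact zero_isDF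
    | succ q => exact gUp_isDF (h p q)

theorem contrM_isMDF {n : ℕ} {Ω : MixedDF n} (h : IsMDF Ω) : IsMDF (contrM Ω) :=
  fun p q => contr_isDF (h _ _)

theorem gIt_isMDF {n : ℕ} {Ω : MixedDF n} (h : IsMDF Ω) (k : ℕ) : IsMDF (gIt k Ω) := by
  induction k with
  | zero => exact h
  | succ k ih => exact gUpM_isMDF ih

/-- Summing a form against the basis in the first slot. -/
theorem IsAltML.sum_basis {n m : ℕ} {f : Form n (m + 1)} (h : IsAltML f) (v : Evec n)
    (z : Fin m → Evec n) :
    ∑ i, ⟪ebasis n i, v⟫ * f (Fin.cons (ebasis n i) z) = f (Fin.cons v z) := by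
  obtain ⟨F, hF⟩ := (isAltML_iff f).1 h
  have hv : v = ∑ i, ⟪ebasis n i, v⟫ • ebasis n i := by
    have := (EuclideanSpace.basisFun (Fin n) ℝ).sum_repr' v
    simpa [ebasis] using this.symm
  let L : Evec n →ₗ[ℝ] ℝ :=
    { toFun := fun w => F.curryLeft w z
      map_add' := fun a b => by rw [map_add]; rfl
      map_smul' := fun c a => by rw [map_smul]; rfl }
  have key : ∀ w : Evec n, f (Fin.cons w z) = L w := fun w => (hF _).symm
  rw [key]
  conv_rhs => rw [hv]
  rw [map_sum]
  refine Finset.sum_congr rfl fun i _ => ?_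
  rw [key, map_smul, smul_eq_mul]

theorem sign_cycle {m : ℕ} (b : Fin (m + 1)) :
    ((Equiv.Perm.sign b.cycleRange.symm : ℤ) : ℝ) = (-1) ^ (b : ℕ) := by
  rw [Equiv.Perm.sign_symm, Fin.sign_cycleRange]; simp

theorem sq_sign (m : ℕ) : (-1 : ℝ) ^ m * (-1) ^ m = 1 := by
  rw [← mul_pow]; simp

theorem IsAltML.cons_self {n m : ℕ} {f : Form n (m + 1)} (h : IsAltML f)
    (y : Fin (m + 1) → Evec n) (b : Fin (m + 1)) :
    (-1 : ℝ) ^ (b : ℕ) * f (Fin.cons (y b) (y ∘ b.succAbove)) = f y := by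
  have e : (Fin.cons (y b) (y ∘ b.succAbove) : Fin (m + 1) → Evec n)
      = fun i => y (b.cycleRange.symm i) := by
    funext i
    refine Fin.cases ?_ (fun j => ?_) i
    · simp
    · simp
  rw [e, h.perm, sign_cycle, ← mul_assoc, sq_sign, one_mul]

theorem cons_comp_succAbove_succ {n m : ℕ} (v : Evec n) (y : Fin (m + 1) → Evec n)
    (b : Fin (m + 1)) :
    (Fin.cons v y : Fin (m + 2) → Evec n) ∘ b.succ.succAbove
      = Fin.cons v (y ∘ b.succAbove) := by
  funext i
  refine Fin.cases ?_ (fun j => ?_) i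
  · simp
  · simp

theorem cons_comp_succAbove_zero {n m : ℕ} (v : Evec n) (y : Fin m → Evec n) :
    (Fin.cons v y : Fin (m + 1) → Evec n) ∘ (0 : Fin (m + 1)).succAbove = y := by
  funext i; simp

theorem ebasis_inner {n : ℕ} (i : Fin n) : ⟪ebasis n i, ebasis n i⟫ = (1 : ℝ) := by
  simp [ebasis]

/-- First correction term. -/
theorem corrR {n p q : ℕ} {ω : DF n p q} (h : IsDF ω) (x : Fin p → Evec n)
    (y : Fin q → Evec n) :
    ∑ i, ∑ b : Fin q, (-1 : ℝ) ^ ((b : ℕ) + 1) * ⟪ebasis n i, y b⟫ *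
      ω x ((Fin.cons (ebasis n i) y : Fin (q + 1) → Evec n) ∘ b.succ.succAbove)
      = -(q : ℝ) * ω x y := by
  cases q with
  | zero => simp
  | succ q =>
    rw [Finset.sum_comm]
    have : ∀ b : Fin (q + 1), ∑ i, (-1 : ℝ) ^ ((b : ℕ) + 1) * ⟪ebasis n i, y b⟫ *
      ω x ((Fin.cons (ebasis n i) y : Fin (q + 2) → Evec n) ∘ b.succ.succAbove)
        = - ω x y := by
      intro b
      have h1 := (h.2 x).sum_basis (y b) (y ∘ b.succAbove)
      have h2 := (h.2 x).cons_self y b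
      rw [← h2, ← h1, Finset.mul_sum, ← Finset.sum_neg_distrib]
      refine Finset.sum_congr rfl fun i _ => ?_
      rw [cons_comp_succAbove_succ, pow_succ]; ring
    rw [Finset.sum_congr rfl fun b _ => this b]
    simp only [Finset.sum_const, Finset.card_univ, Fintype.card_fin, nsmul_eq_mul]
    push_cast; ring

theorem corrL {n p q : ℕ} {ω : DF n p q} (h : IsDF ω) (x : Fin p → Evec n)
    (y : Fin q → Evec n) :
    ∑ i, ∑ a : Fin p, (-1 : ℝ) ^ ((a : ℕ) + 1) * ⟪x a, ebasis n i⟫ *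
      ω ((Fin.cons (ebasis n i) x : Fin (p + 1) → Evec n) ∘ a.succ.succAbove) y
      = -(p : ℝ) * ω x y := by
  have h' : IsDF (transp ω) := ⟨h.2, h.1⟩
  have := corrR h' y x
  simp only [transp] at this
  rw [← this]
  refine Finset.sum_congr rfl fun i _ => Finset.sum_congr rfl fun a _ => ?_
  rw [real_inner_comm]

theorem contr_gUp_apply {n p q : ℕ} {ω : DF n p q} (h : IsDF ω) (x : Fin p → Evec n)
    (y : Fin q → Evec n) :
    contr (gUp ω) x y = ((n : ℝ) - p - q) * ω x y +
      ∑ i, ∑ a : Fin p, ∑ b : Fin q, (-1 : ℝ) ^ (a : ℕ) * (-1 : ℝ) ^ (b : ℕ) * ⟪x a, y b⟫ *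
        ω ((Fin.cons (ebasis n i) x : Fin (p + 1) → Evec n) ∘ a.succ.succAbove)
          ((Fin.cons (ebasis n i) y : Fin (q + 1) → Evec n) ∘ b.succ.succAbove) := by
  have hs : ((n : ℝ) - p - q) * ω x y
      = ∑ _i : Fin n, ω x y + -(q : ℝ) * ω x y + -(p : ℝ) * ω x y := by
    simp; ring
  rw [hs, ← corrR h x y, ← corrL h x y, ← Finset.sum_add_distrib, ← Finset.sum_add_distrib,
    ← Finset.sum_add_distrib]
  unfold contr gUp
  refine Finset.sum_congr rfl fun i _ => ?_
  rw [Fin.sum_univ_succ, Fin.sum_univ_succ]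
  simp only [Fin.sum_univ_succ (n := q), Fin.cons_zero, Fin.cons_succ, cons_comp_succAbove_zero,
    ebasis_inner, Finset.sum_add_distrib, Fin.val_zero, pow_zero, one_mul, Fin.val_succ, mul_one]
  rw [add_assoc (_ + _)]
  congr 1
  congr 1
  refine Finset.sum_congr rfl fun a _ => Finset.sum_congr rfl fun b _ => ?_
  rw [pow_succ, pow_succ]; ring

theorem contrM_gUpM {n : ℕ} {Ω : MixedDF n} (h : IsMDF Ω) (p q : ℕ) :
    contrM (gUpM Ω) p q = gUpM (contrM Ω) p q + ((n : ℝ) - p - q) • Ω p q := by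
  have e : contrM (gUpM Ω) p q = contr (gUp (Ω p q)) := rfl
  rw [e]
  funext x y
  rw [contr_gUp_apply (h p q), add_comm]
  congr 1
  cases p with
  | zero => simp [gUpM]
  | succ p =>
    cases q with
    | zero => simp [gUpM]
    | succ q =>
      simp only [gUpM, gUp, contrM, contr, cons_comp_succAbove_succ]
      rw [Finset.sum_comm]
      refine Finset.sum_congr rfl fun a _ => ?_
      rw [Finset.sum_comm]
      refine Finset.sum_congr rfl fun b _ => ?_
      rw [Finset.mul_sum]

theorem gUp_zero {n p q : ℕ} : gUp (0 : DF n p q) = 0 := by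
  funext x y; simp [gUp]

theorem gUp_add {n p q : ℕ} (ω η : DF n p q) : gUp (ω + η) = gUp ω + gUp η := by
  funext x y
  simp [gUp, mul_add, Finset.sum_add_distrib]

theorem gUp_smul {n p q : ℕ} (c : ℝ) (ω : DF n p q) : gUp (c • ω) = c • gUp ω := by
  funext x y
  simp only [gUp, Pi.smul_apply, smul_eq_mul, Finset.mul_sum]
  refine Finset.sum_congr rfl fun a _ => Finset.sum_congr rfl fun b _ => ?_
  ring

theorem contr_zero {n p q : ℕ} : contr (0 : DF n (p + 1) (q + 1)) = 0 := by
  funext x y; simp [contr]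

theorem gIt_comm {n : ℕ} {Ω : MixedDF n} (h : IsMDF Ω) (p q k : ℕ) :
    contrM (gIt (k + 1) Ω) (p + k) (q + k) = gIt (k + 1) (contrM Ω) (p + k) (q + k) +
      (((k : ℝ) + 1) * ((n : ℝ) - p - q - k)) • gIt k Ω (p + k) (q + k) := by
  induction k with
  | zero =>
    have := contrM_gUpM h p q
    simpa [gIt] using this
  | succ k ih =>
    have e := contrM_gUpM (gIt_isMDF h (k + 1)) (p + (k + 1)) (q + (k + 1))
    have e1 : gUpM (contrM (gIt (k + 1) Ω)) (p + (k + 1)) (q + (k + 1))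
        = gUp (contrM (gIt (k + 1) Ω) (p + k) (q + k)) := rfl
    rw [e1, ih, gUp_add, gUp_smul] at e
    have e2 : gUp (gIt k Ω (p + k) (q + k)) = gIt (k + 1) Ω (p + (k + 1)) (q + (k + 1)) := rfl
    have e3 : gUp (gIt (k + 1) (contrM Ω) (p + k) (q + k))
      = gIt (k + 2) (contrM Ω) (p + (k + 1)) (q + (k + 1)) := rfl
    rw [e2, e3, add_assoc, ← add_smul] at e
    refine e.trans ?_
    congr 2
    push_cast; ring

theorem gIt_low {n : ℕ} (Ω : MixedDF n) (k a b : ℕ) (hab : a < k ∨ b < k) :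
    gIt k Ω a b = 0 := by
  induction k generalizing a b with
  | zero => omega
  | succ k ih =>
    cases a with
    | zero => rfl
    | succ a =>
      cases b with
      | zero => rfl
      | succ b =>
        change gUp (gIt k Ω a b) = 0
        rw [ih a b (by omega), gUp_zero]

theorem gIt_zero {n : ℕ} (Ω : MixedDF n) (p q k : ℕ) (h : Ω p q = 0) :
    gIt k Ω (p + k) (q + k) = 0 := by
  induction k with
  | zero => exact h
  | succ k ih =>
    change gUp (gIt k Ω (p + k) (q + k)) = 0
    rw [ih, gUp_zero]

theorem lefschetz {n : ℕ} (p : ℕ) : ∀ (q k : ℕ) (Ω : MixedDF n), IsMDF Ω → p + q + k ≤ n →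
    gIt k Ω (p + k) (q + k) = 0 → Ω p q = 0 := by
  induction p with
  | zero =>
    intro q k Ω hΩ
    induction k with
    | zero => intro _ h; exact h
    | succ k ih =>
      intro hn h
      apply ih (by omega)
      have e := gIt_comm hΩ 0 q k
      have e0 : contrM (gIt (k + 1) Ω) (0 + k) (q + k) = 0 := by
        change contr (gIt (k + 1) Ω (0 + (k + 1)) (q + (k + 1))) = 0
        rw [h, contr_zero]
      rw [e0, gIt_low (contrM Ω) (k + 1) (0 + k) (q + k) (by omega), zero_add (_ • _)] at e
      refine (smul_eq_zero.1 e.symm).resolve_left ?_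
      have : ((0 + q + (k + 1) : ℕ) : ℝ) ≤ n := by exact_mod_cast hn
      push_cast at this ⊢
      apply mul_ne_zero
      · positivity
      · linarith
  | succ p ihp =>
    intro q k Ω hΩ
    induction k with
    | zero => intro _ h; exact h
    | succ k ih =>
      intro hn h
      apply ih (by omega)
      have e := gIt_comm hΩ (p + 1) q k
      have e0 : contrM (gIt (k + 1) Ω) (p + 1 + k) (q + k) = 0 := by
        change contr (gIt (k + 1) Ω (p + 1 + (k + 1)) (q + (k + 1))) = 0
        rw [h, contr_zero]
      have e1 : gIt (k + 1) (contrM Ω) (p + 1 + k) (q + k) = 0 := by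
        cases q with
        | zero => exact gIt_low _ _ _ _ (by omega)
        | succ q =>
          have hz : contrM Ω p q = 0 := by
            apply ihp q (k + 2) (contrM Ω) (contrM_isMDF hΩ) (by omega)
            have e' := congrArg gUp e
            rw [e0, gUp_add, gUp_smul, gUp_zero] at e'
            have e2 : gUp (gIt k Ω (p + 1 + k) (q + 1 + k))
              = gIt (k + 1) Ω (p + 1 + (k + 1)) (q + 1 + (k + 1)) := rfl
            rw [e2, h, smul_zero, add_zero] at e'
            have i1 : p + (k + 2) = p + 1 + k + 1 := by omega
            have i2 : q + (k + 2) = q + 1 + k + 1 := by omega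
            rw [i1, i2]
            exact e'.symm
          have i1 : p + 1 + k = p + (k + 1) := by omega
          have i2 : q + 1 + k = q + (k + 1) := by omega
          rw [i1, i2]
          exact gIt_zero _ _ _ _ hz
      rw [e0, e1, zero_add] at e
      refine (smul_eq_zero.1 e.symm).resolve_left ?_
      have : ((p + 1 + q + (k + 1) : ℕ) : ℝ) ≤ n := by exact_mod_cast hn
      push_cast at this ⊢
      apply mul_ne_zero
      · positivity
      · linarith

/-! ### Relating `wedge (gpow n k)` with the iterates of `gUp` -/

/-- Real-valued sign. -/
def sg {m : ℕ} (σ : Equiv.Perm (Fin m)) : ℝ := ((Equiv.Perm.sign σ : ℤ) : ℝ)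

theorem sg_mul {m : ℕ} (σ τ : Equiv.Perm (Fin m)) : sg (σ * τ) = sg σ * sg τ := by
  simp [sg]

theorem sg_sq {m : ℕ} (σ : Equiv.Perm (Fin m)) : sg σ * sg σ = 1 := by
  rcases Int.units_eq_one_or (Equiv.Perm.sign σ) with h | h <;> simp [sg, h]

/-- Absorbing an inner antisymmetrization, one block. -/
theorem absorb {m : ℕ} {α : Type*} [Fintype α] (e : α → Equiv.Perm (Fin m))
    (F : Equiv.Perm (Fin m) → ℝ) :
    ∑ σ, sg σ * ∑ a, sg (e a) * F (σ * e a) = (Fintype.card α : ℝ) * ∑ σ, sg σ * F σ := by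
  simp only [Finset.mul_sum]
  rw [Finset.sum_comm]
  have : ∀ a, ∑ σ, sg σ * (sg (e a) * F (σ * e a)) = ∑ σ, sg σ * F σ := by
    intro a
    rw [← Equiv.sum_comp (Equiv.mulRight (e a)) (fun σ => sg σ * F σ)]
    refine Finset.sum_congr rfl fun σ _ => ?_
    simp only [Equiv.coe_mulRight, sg_mul, mul_assoc]
  rw [Finset.sum_congr rfl fun a _ => this a]
  simp [Finset.mul_sum]

/-- Absorbing, two blocks. -/
theorem absorb2 {m l : ℕ} {α β : Type*} [Fintype α] [Fintype β]
    (e : α → Equiv.Perm (Fin m)) (f : β → Equiv.Perm (Fin l))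
    (F : Equiv.Perm (Fin m) → Equiv.Perm (Fin l) → ℝ) :
    ∑ σ, ∑ τ, sg σ * sg τ * ∑ a, ∑ b, sg (e a) * sg (f b) * F (σ * e a) (τ * f b)
      = (Fintype.card α : ℝ) * Fintype.card β * ∑ σ, ∑ τ, sg σ * sg τ * F σ τ := by
  have h1 : ∀ σ a, ∑ τ, sg τ * ∑ b, sg (f b) * F (σ * e a) (τ * f b)
      = (Fintype.card β : ℝ) * ∑ τ, sg τ * F (σ * e a) τ := fun σ a => absorb f _
  have h2 := absorb e (fun σ => (Fintype.card β : ℝ) * ∑ τ, sg τ * F σ τ)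
  simp only [← h1] at h2
  have h3 : ∑ σ, ∑ τ, sg σ * sg τ * ∑ a, ∑ b, sg (e a) * sg (f b) * F (σ * e a) (τ * f b)
      = ∑ σ, sg σ * ∑ a, sg (e a) * ∑ τ, sg τ * ∑ b, sg (f b) * F (σ * e a) (τ * f b) := by
    refine Finset.sum_congr rfl fun σ _ => ?_
    simp only [Finset.mul_sum]
    rw [Finset.sum_comm]
    refine Finset.sum_congr rfl fun a _ => Finset.sum_congr rfl fun τ _ =>
      Finset.sum_congr rfl fun b _ => ?_
    ring
  rw [h3, h2, mul_assoc]
  congr 1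
  simp only [Finset.mul_sum]
  refine Finset.sum_congr rfl fun σ _ => Finset.sum_congr rfl fun τ _ => ?_
  ring

/-- Extend a permutation of the first `m` indices. -/
def extL (m r : ℕ) (σ : Equiv.Perm (Fin m)) : Equiv.Perm (Fin (m + r)) :=
  finSumFinEquiv.permCongr (Equiv.sumCongr σ 1)

/-- Extend a permutation of the last `r` indices. -/
def extR (m r : ℕ) (σ : Equiv.Perm (Fin r)) : Equiv.Perm (Fin (m + r)) :=
  finSumFinEquiv.permCongr (Equiv.sumCongr 1 σ)

theorem sg_extL (m r : ℕ) (σ : Equiv.Perm (Fin m)) : sg (extL m r σ) = sg σ := by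
  simp only [sg, extL, Equiv.Perm.sign_permCongr]
  have := Equiv.Perm.sign_sumCongr σ (1 : Equiv.Perm (Fin r))
  rw [show (Equiv.sumCongr σ (1 : Equiv.Perm (Fin r))) = Equiv.Perm.sumCongr σ 1 from rfl, this]
  simp

theorem sg_extR (m r : ℕ) (σ : Equiv.Perm (Fin r)) : sg (extR m r σ) = sg σ := by
  simp only [sg, extR, Equiv.Perm.sign_permCongr]
  have := Equiv.Perm.sign_sumCongr (1 : Equiv.Perm (Fin m)) σ
  rw [show (Equiv.sumCongr (1 : Equiv.Perm (Fin m)) σ) = Equiv.Perm.sumCongr 1 σ from rfl, this]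
  simp

theorem extL_castAdd (m r : ℕ) (σ : Equiv.Perm (Fin m)) (i : Fin m) :
    extL m r σ (Fin.castAdd r i) = Fin.castAdd r (σ i) := by
  simp [extL, Equiv.permCongr_apply]

theorem extL_natAdd (m r : ℕ) (σ : Equiv.Perm (Fin m)) (i : Fin r) :
    extL m r σ (Fin.natAdd m i) = Fin.natAdd m i := by
  simp [extL, Equiv.permCongr_apply]

theorem extR_castAdd (m r : ℕ) (σ : Equiv.Perm (Fin r)) (i : Fin m) :
    extR m r σ (Fin.castAdd r i) = Fin.castAdd r i := by
  simp [extR, Equiv.permCongr_apply]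

theorem extR_natAdd (m r : ℕ) (σ : Equiv.Perm (Fin r)) (i : Fin r) :
    extR m r σ (Fin.natAdd m i) = Fin.natAdd m (σ i) := by
  simp [extR, Equiv.permCongr_apply]

/-- The unnormalized triple product. -/
def tri {n k p q : ℕ} (γ : DF n k k) (ω : DF n p q)
    (x : Fin (k + 1 + p) → Evec n) (y : Fin (k + 1 + q) → Evec n) : ℝ :=
  γ (fun i => x (Fin.castAdd p (Fin.castAdd 1 i))) (fun i => y (Fin.castAdd q (Fin.castAdd 1 i))) *
    ⟪x (Fin.castAdd p (Fin.natAdd k 0)), y (Fin.castAdd q (Fin.natAdd k 0))⟫ *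
    ω (fun i => x (Fin.natAdd (k + 1) i)) (fun i => y (Fin.natAdd (k + 1) i))

theorem wedge_left {n k p q : ℕ} (γ : DF n k k) (ω : DF n p q)
    (x : Fin (k + 1 + p) → Evec n) (y : Fin (k + 1 + q) → Evec n) :
    ∃ c : ℝ, c ≠ 0 ∧ wedge (wedge γ (gdf n)) ω x y =
      c * ∑ σ, ∑ τ, sg σ * sg τ * tri γ ω (x ∘ σ) (y ∘ τ) := by
  have h := absorb2 (extL (k + 1) p) (extL (k + 1) q)
    (fun σ τ => tri γ ω (x ∘ σ) (y ∘ τ))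
  refine ⟨((((k+1).factorial * p.factorial * (k+1).factorial * q.factorial : ℕ) : ℝ))⁻¹ *
    (((k.factorial * (1).factorial * k.factorial * (1).factorial : ℕ) : ℝ))⁻¹ *
    ((Fintype.card (Equiv.Perm (Fin (k+1))) : ℝ) * Fintype.card (Equiv.Perm (Fin (k+1)))),
    ?_, ?_⟩
  · have h1 : (Fintype.card (Equiv.Perm (Fin (k+1))) : ℝ) ≠ 0 := by
      exact_mod_cast Fintype.card_ne_zero
    have h2 : ∀ m : ℕ, m.factorial ≠ 0 := Nat.factorial_ne_zero
    refine mul_ne_zero (mul_ne_zero (inv_ne_zero ?_) (inv_ne_zero ?_)) (mul_ne_zero h1 h1)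
    · exact_mod_cast mul_ne_zero (mul_ne_zero (mul_ne_zero (h2 _) (h2 _)) (h2 _)) (h2 _)
    · exact_mod_cast mul_ne_zero (mul_ne_zero (mul_ne_zero (h2 _) (h2 _)) (h2 _)) (h2 _)
  · rw [mul_assoc, ← h, mul_assoc]
    conv_lhs => unfold wedge
    congr 1
    rw [Finset.mul_sum]
    refine Finset.sum_congr rfl fun σ _ => ?_
    rw [Finset.mul_sum]
    refine Finset.sum_congr rfl fun τ _ => ?_
    simp only [Finset.mul_sum, Finset.sum_mul]
    refine Finset.sum_congr rfl fun σ' _ => Finset.sum_congr rfl fun τ' _ => ?_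
    simp only [sg_extL, tri, Function.comp, Equiv.Perm.mul_apply, extL_castAdd, extL_natAdd, gdf]
    simp only [sg]
    ring

/-- Same as `tri`, indexed by `k + (p + 1)`. -/
def tri' {n k p q : ℕ} (γ : DF n k k) (ω : DF n p q)
    (x : Fin (k + (p + 1)) → Evec n) (y : Fin (k + (q + 1)) → Evec n) : ℝ :=
  γ (fun i => x (Fin.castAdd (p + 1) i)) (fun i => y (Fin.castAdd (q + 1) i)) *
    ⟪x (Fin.natAdd k 0), y (Fin.natAdd k 0)⟫ *
    ω (fun i => x (Fin.natAdd k i.succ)) (fun i => y (Fin.natAdd k i.succ))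

theorem wedge_right {n k p q : ℕ} (γ : DF n k k) (ω : DF n p q)
    (x : Fin (k + (p + 1)) → Evec n) (y : Fin (k + (q + 1)) → Evec n) :
    ∃ c : ℝ, c ≠ 0 ∧ wedge γ (gUp ω) x y =
      c * ∑ σ, ∑ τ, sg σ * sg τ * tri' γ ω (x ∘ σ) (y ∘ τ) := by
  have h := absorb2 (fun a : Fin (p + 1) => extR k (p + 1) a.cycleRange.symm)
    (fun b : Fin (q + 1) => extR k (q + 1) b.cycleRange.symm)
    (fun σ τ => tri' γ ω (x ∘ σ) (y ∘ τ))
  refine ⟨(((k.factorial * (p+1).factorial * k.factorial * (q+1).factorial : ℕ) : ℝ))⁻¹ *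
    ((Fintype.card (Fin (p+1)) : ℝ) * Fintype.card (Fin (q+1))),
    ?_, ?_⟩
  · have h2 : ∀ m : ℕ, m.factorial ≠ 0 := Nat.factorial_ne_zero
    refine mul_ne_zero (inv_ne_zero ?_) (mul_ne_zero ?_ ?_)
    · exact_mod_cast mul_ne_zero (mul_ne_zero (mul_ne_zero (h2 _) (h2 _)) (h2 _)) (h2 _)
    · exact_mod_cast Fintype.card_ne_zero
    · exact_mod_cast Fintype.card_ne_zero
  · rw [mul_assoc, ← h]
    conv_lhs => unfold wedge
    congr 1
    refine Finset.sum_congr rfl fun σ _ => Finset.sum_congr rfl fun τ _ => ?_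
    unfold gUp
    simp only [Finset.mul_sum]
    refine Finset.sum_congr rfl fun a _ => Finset.sum_congr rfl fun b _ => ?_
    simp only [sg_extR, tri', Function.comp_def, Equiv.Perm.mul_apply, extR_castAdd, extR_natAdd,
      Fin.cycleRange_symm_zero, Fin.cycleRange_symm_succ]
    simp only [sg, sign_cycle]
    ring

theorem sum_cast {n a b a' b' : ℕ} (h : a = b) (h' : a' = b')
    (F : (Fin a → Evec n) → (Fin a' → Evec n) → ℝ)
    (x : Fin b → Evec n) (y : Fin b' → Evec n) :
    ∑ σ : Equiv.Perm (Fin b), ∑ τ : Equiv.Perm (Fin b'), sg σ * sg τ *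
      F ((x ∘ σ) ∘ Fin.cast h) ((y ∘ τ) ∘ Fin.cast h') =
    ∑ σ : Equiv.Perm (Fin a), ∑ τ : Equiv.Perm (Fin a'), sg σ * sg τ *
      F ((x ∘ Fin.cast h) ∘ σ) ((y ∘ Fin.cast h') ∘ τ) := by
  subst h h'; rfl

theorem tri_eq {n k p q : ℕ} (γ : DF n k k) (ω : DF n p q)
    (h : k + 1 + p = k + (p + 1)) (h' : k + 1 + q = k + (q + 1))
    (x : Fin (k + (p + 1)) → Evec n) (y : Fin (k + (q + 1)) → Evec n) :
    tri' γ ω x y = tri γ ω (x ∘ Fin.cast h) (y ∘ Fin.cast h') := by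
  have c1 : ∀ (r : ℕ) (h : k + 1 + r = k + (r + 1)) (i : Fin k),
      Fin.cast h (Fin.castAdd r (Fin.castAdd 1 i)) = Fin.castAdd (r + 1) i := by
    intro r h i; ext; simp
  have c2 : ∀ (r : ℕ) (h : k + 1 + r = k + (r + 1)),
      Fin.cast h (Fin.castAdd r (Fin.natAdd k 0)) = Fin.natAdd k 0 := by
    intro r h; ext; simp
  have c3 : ∀ (r : ℕ) (h : k + 1 + r = k + (r + 1)) (i : Fin r),
      Fin.cast h (Fin.natAdd (k + 1) i) = Fin.natAdd k i.succ := by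
    intro r h i; ext; simp; omega
  simp only [tri, tri', Function.comp, c1, c2, c3]

theorem wedge_step {n k p q : ℕ} (γ : DF n k k) (ω : DF n p q)
    (h0 : wedge (wedge γ (gdf n)) ω = 0) : wedge γ (gUp ω) = 0 := by
  funext x y
  have h : k + 1 + p = k + (p + 1) := by omega
  have h' : k + 1 + q = k + (q + 1) := by omega
  obtain ⟨c, hc, e⟩ := wedge_left γ ω (x ∘ Fin.cast h) (y ∘ Fin.cast h')
  obtain ⟨d, hd, e'⟩ := wedge_right γ ω x y
  rw [e']
  simp only [tri_eq γ ω h h']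
  rw [sum_cast h h' (tri γ ω) x y]
  rw [h0] at e
  have := (mul_eq_zero.1 e.symm).resolve_left hc
  rw [this, mul_zero]; rfl

theorem wedge_one {n p q : ℕ} {ω : DF n p q} (hω : IsDF ω)
    (h0 : wedge (gpow n 0) ω = 0) : ω = 0 := by
  funext x y
  have hp : 0 + p = p := by omega
  have hq : 0 + q = q := by omega
  have e := congrFun (congrFun h0 (x ∘ Fin.cast hp)) (y ∘ Fin.cast hq)
  have hf : ∀ m : ℕ, m.factorial ≠ 0 := Nat.factorial_ne_zero
  unfold wedge at e
  have e1 := (mul_eq_zero.1 e).resolve_left (inv_ne_zero (by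
    exact_mod_cast mul_ne_zero (mul_ne_zero (mul_ne_zero (hf _) (hf _)) (hf _)) (hf _)))
  have e2 := sum_cast hp hq (fun u v => ω (fun i => u (Fin.natAdd 0 i)) (fun i => v (Fin.natAdd 0 i)))
    x y
  have e3 : ∑ σ : Equiv.Perm (Fin p), ∑ τ : Equiv.Perm (Fin q), sg σ * sg τ *
      ω (fun i => x (σ i)) (fun i => y (τ i)) = 0 := by
    have c : ∀ (m : ℕ) (h : 0 + m = m) (i : Fin m), Fin.cast h (Fin.natAdd 0 i) = i := by
      intro m h i; ext; simp
    simp only [Function.comp, c] at e2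
    rw [e2, ← e1]
    refine Finset.sum_congr rfl fun σ _ => Finset.sum_congr rfl fun τ _ => ?_
    simp [gpow, sg]
  have e4 : ∀ (σ : Equiv.Perm (Fin p)) (τ : Equiv.Perm (Fin q)),
      sg σ * sg τ * ω (fun i => x (σ i)) (fun i => y (τ i)) = ω x y := by
    intro σ τ
    have a1 : ω (fun i => x (σ i)) (fun i => y (τ i)) = sg σ * ω x (fun i => y (τ i)) :=
      (hω.1 (fun i => y (τ i))).perm x σ
    have a2 : ω x (fun i => y (τ i)) = sg τ * ω x y := (hω.2 x).perm y τ
    rw [a1, a2]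
    calc _ = (sg σ * sg σ) * (sg τ * sg τ) * ω x y := by ring
      _ = _ := by rw [sg_sq, sg_sq]; ring
  simp only [e4, Finset.sum_const, Finset.card_univ, nsmul_eq_mul] at e3
  have n1 : (Fintype.card (Equiv.Perm (Fin p)) : ℝ) ≠ 0 := by
    exact_mod_cast Fintype.card_ne_zero
  have n2 : (Fintype.card (Equiv.Perm (Fin q)) : ℝ) ≠ 0 := by
    exact_mod_cast Fintype.card_ne_zero
  exact (mul_eq_zero.1 ((mul_eq_zero.1 e3).resolve_left n1)).resolve_left n2

theorem gIt_gUpM {n : ℕ} (k : ℕ) (Ω : MixedDF n) : gIt k (gUpM Ω) = gIt (k + 1) Ω := by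
  induction k with
  | zero => rfl
  | succ k ih =>
    change gUpM (gIt k (gUpM Ω)) = _
    rw [ih]; rfl

theorem wedge_gIt {n : ℕ} (k : ℕ) : ∀ (p q : ℕ) (Ω : MixedDF n), IsMDF Ω →
    wedge (gpow n k) (Ω p q) = 0 → gIt k Ω (p + k) (q + k) = 0 := by
  induction k with
  | zero => intro p q Ω h h0; exact wedge_one (h p q) h0
  | succ k ih =>
    intro p q Ω h h0
    have := ih (p + 1) (q + 1) (gUpM Ω) (gUpM_isMDF h) (wedge_step (gpow n k) (Ω p q) h0)
    rw [gIt_gUpM] at this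
    have i1 : p + (k + 1) = p + 1 + k := by omega
    have i2 : q + (k + 1) = q + 1 + k := by omega
    rw [i1, i2]; exact this

theorem embDF_self {n p q : ℕ} (ω : DF n p q) : embDF p q ω p q = ω := by
  simp [embDF]

theorem embDF_isMDF {n p q : ℕ} {ω : DF n p q} (h : IsDF ω) : IsMDF (embDF p q ω) := by
  intro a b
  by_cases hab : a = p ∧ b = q
  · obtain ⟨rfl, rfl⟩ := hab
    rw [embDF_self]; exact h
  · simp only [embDF, hab, dite_false]; exact zero_isDF

/-- If `ω` is a `(p,q)` double form with `p + q + k < n + 1` and `k ≥ 1`,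
then `gᵏ · ω = 0` implies `ω = 0`. -/
theorem statement8 (n p q k : ℕ) (hk : 1 ≤ k) (hdeg : p + q + k < n + 1)
    (ω : DF n p q) (hω : IsDF ω) (h0 : wedge (gpow n k) ω = 0) : ω = 0 := by
  have hΩ := embDF_isMDF hω
  have h1 := wedge_gIt k p q (embDF p q ω) hΩ (by rw [embDF_self]; exact h0)
  have h2 := lefschetz p q k (embDF p q ω) hΩ (by omega) h1
  rwa [embDF_self] at h2
end
end

section
/- For a simple (2,2) double form α = α₁⊗α₂ and a (p,q) double form ω, the sharp product satisfies α # ω = −4 · (g^{q−1}ρ(α₂)/(q−1)!) ∘ ω ∘ (g^{p−1}ρ(α₁)/(p−1)!), with the convention g^{−1} = 0. -/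
noncomputable section

open Finset
open scoped RealInnerProductSpace

/-! ### Auxiliary lemmas -/

lemma altML_iff {n m : ℕ} (f : Form n m) :
    IsAltML f ↔ ∃ F : (Evec n) [⋀^Fin m]→ₗ[ℝ] ℝ, f = fun x => F x := by
  constructor
  · rintro ⟨h1, h2⟩
    have hadd : ∀ (x : Fin m → Evec n) (i : Fin m) (a b : Evec n),
        f (Function.update x i (a + b)) =
          f (Function.update x i a) + f (Function.update x i b) := by
      intro x i a b
      have := h1 x i 1 a b
      simpa using this
    have hzero : ∀ (x : Fin m → Evec n) (i : Fin m), f (Function.update x i 0) = 0 := by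
      intro x i
      have := hadd x i 0 0
      simpa using this
    have hsmul : ∀ (x : Fin m → Evec n) (i : Fin m) (c : ℝ) (a : Evec n),
        f (Function.update x i (c • a)) = c * f (Function.update x i a) := by
      intro x i c a
      have := h1 x i c a 0
      simpa [hzero] using this
    refine ⟨{ toFun := f
              map_update_add' := ?_
              map_update_smul' := ?_
              map_eq_zero_of_eq' := ?_ }, rfl⟩
    · intro inst x i a b
      have : inst = instDecidableEqFin m := Subsingleton.elim _ _
      subst this
      exact hadd x i a b
    · intro inst x i c a
      have : inst = instDecidableEqFin m := Subsingleton.elim _ _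
      subst this
      exact hsmul x i c a
    · intro x i j hx hij
      exact h2 x i j hij hx
  · rintro ⟨F, rfl⟩
    refine ⟨?_, ?_⟩
    · intro x i c a b
      simp [AlternatingMap.map_update_add, AlternatingMap.map_update_smul]
    · intro x i j hij hx
      exact F.map_eq_zero_of_eq x hx hij

/-- replace one slot: `∑ₖ ⟪v, xₖ⟫ S(x₁,…,w,…)`. -/
def repl {n m : ℕ} (S : Form n m) (v w : Evec n) (x : Fin m → Evec n) : ℝ :=
  ∑ k, ⟪v, x k⟫ * S (Function.update x k w)

lemma altML_cons_succAbove {n m : ℕ} {S : Form n (m + 1)} (hS : IsAltML S) (w : Evec n)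
    (x : Fin (m + 1) → Evec n) (k : Fin (m + 1)) :
    (-1 : ℝ) ^ (k : ℕ) * S (Fin.cons w (x ∘ k.succAbove)) = S (Function.update x k w) := by
  obtain ⟨F, rfl⟩ := (altML_iff S).1 hS
  have h := F.map_insertNth k w (x ∘ k.succAbove)
  have e : k.insertNth w (x ∘ k.succAbove) = Function.update x k w := by
    exact Fin.insertNth_removeNth k w x
  rw [e] at h
  simp only [h, Matrix.vecCons]
  simp

lemma wedge_iota {n m : ℕ} {S : Form n (m + 1)} (hS : IsAltML S) (v w : Evec n)
    (x : Fin (m + 1) → Evec n) :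
    wedgeC (fun u => ⟪v, u⟫) (iotaV' w S) x = repl S v w x := by
  unfold wedgeC iotaV' repl
  refine Finset.sum_congr rfl fun k _ => ?_
  rw [← altML_cons_succAbove hS w x k]
  ring

lemma iota_wedge {n m : ℕ} {S : Form n m} (hS : IsAltML S) (v w : Evec n)
    (x : Fin m → Evec n) :
    iotaV' w (wedgeC (fun u => ⟪v, u⟫) S) x = ⟪v, w⟫ * S x - repl S v w x := by
  unfold wedgeC iotaV' repl
  beta_reduce
  rw [Fin.sum_univ_succ, sub_eq_add_neg, ← Finset.sum_neg_distrib]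
  congr 1
  · have : (Fin.cons w x : Fin (m+1) → Evec n) ∘ (0 : Fin (m+1)).succAbove = x := by
      ext i; simp
    rw [this]; simp
  · refine Finset.sum_congr rfl fun k _ => ?_
    cases m with
    | zero => exact k.elim0
    | succ m =>
      rw [← altML_cons_succAbove hS w x k]
      have : (Fin.cons w x : Fin (m+1+1) → Evec n) ∘ k.succ.succAbove
          = Fin.cons w (x ∘ k.succAbove) := by
        funext i
        refine Fin.cases ?_ (fun j => ?_) i <;> simp
      rw [this]
      simp [pow_succ]
      ring

lemma iota_iota {n m : ℕ} {S : Form n (m + 1 + 1)} (hS : IsAltML S) (v w : Evec n)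
    (x : Fin m → Evec n) :
    iotaV' v (iotaV' w S) x = - iotaV' w (iotaV' v S) x := by
  obtain ⟨F, rfl⟩ := (altML_iff S).1 hS
  unfold iotaV'
  have h := F.map_swap (Fin.cons w (Fin.cons v x)) (i := 0) (j := 1) (by simp)
  beta_reduce
  rw [← neg_eq_iff_eq_neg, ← h]
  congr 1
  funext i
  refine Fin.cases ?_ (fun j => ?_) i
  · simp
  · refine Fin.cases ?_ (fun j => ?_) j
    · simp
    · rw [Function.comp_apply, Equiv.swap_apply_of_ne_of_ne]
      · simp
      · simp
      · simp [Fin.ext_iff]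

lemma wedge_wedge {n m : ℕ} (S : Form n m) (f g : Evec n → ℝ) (x : Fin (m + 1 + 1) → Evec n) :
    wedgeC f (wedgeC g S) x = - wedgeC g (wedgeC f S) x := by
  unfold wedgeC
  simp only [Finset.mul_sum, ← Finset.sum_neg_distrib]
  rw [← Fintype.sum_prod_type', ← Fintype.sum_prod_type']
  refine Finset.sum_nbij' (fun a => (a.1.succAbove a.2, a.2.predAbove a.1))
    (fun a => (a.1.succAbove a.2, a.2.predAbove a.1)) ?_ ?_ ?_ ?_ ?_
  · simp
  · simp
  · rintro ⟨i, j⟩ _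
    simp [Fin.succAbove_succAbove_predAbove, Fin.predAbove_predAbove_succAbove]
  · rintro ⟨i, j⟩ _
    simp [Fin.succAbove_succAbove_predAbove, Fin.predAbove_predAbove_succAbove]
  · rintro ⟨i, j⟩ _
    have h := Fin.neg_one_pow_succAbove_add_predAbove (R := ℝ) i j
    have e : (x ∘ (i.succAbove j).succAbove) ∘ (j.predAbove i).succAbove
        = (x ∘ i.succAbove) ∘ j.succAbove := by
      funext k
      simp [Fin.succAbove_succAbove_succAbove_predAbove]
    simp only [Function.comp_apply, Fin.succAbove_succAbove_predAbove]
    rw [e]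
    rw [pow_add, pow_add] at h
    linear_combination ((f (x i) * g (x (i.succAbove j)) *
      S ((x ∘ i.succAbove) ∘ j.succAbove))) * h

lemma wedgeC_add {n m : ℕ} (f : Evec n → ℝ) (S T : Form n m) :
    wedgeC f (S + T) = wedgeC f S + wedgeC f T := by
  funext x; simp [wedgeC, mul_add, Finset.sum_add_distrib]

lemma wedgeC_sub {n m : ℕ} (f : Evec n → ℝ) (S T : Form n m) :
    wedgeC f (S - T) = wedgeC f S - wedgeC f T := by
  funext x; simp [wedgeC, mul_sub, Finset.sum_sub_distrib]

lemma wedgeC_neg {n m : ℕ} (f : Evec n → ℝ) (S : Form n m) :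
    wedgeC f (-S) = - wedgeC f S := by
  funext x; simp [wedgeC]

lemma wedgeC_smul {n m : ℕ} (f : Evec n → ℝ) (c : ℝ) (S : Form n m) :
    wedgeC f (c • S) = c • wedgeC f S := by
  funext x; simp only [wedgeC, Pi.smul_apply, smul_eq_mul, Finset.mul_sum]
  refine Finset.sum_congr rfl fun k _ => ?_
  ring

lemma iotaV'_add {n m : ℕ} (v : Evec n) (S T : Form n (m+1)) :
    iotaV' v (S + T) = iotaV' v S + iotaV' v T := rfl
lemma iotaV'_sub {n m : ℕ} (v : Evec n) (S T : Form n (m+1)) :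
    iotaV' v (S - T) = iotaV' v S - iotaV' v T := rfl
lemma iotaV'_neg {n m : ℕ} (v : Evec n) (S : Form n (m+1)) :
    iotaV' v (-S) = - iotaV' v S := rfl
lemma iotaV'_smul {n m : ℕ} (v : Evec n) (c : ℝ) (S : Form n (m+1)) :
    iotaV' v (c • S) = c • iotaV' v S := rfl

lemma comm_pair {n : ℕ} (S : MixedForm n) (hS : ∀ d, IsAltML (S d)) (v w : Evec n) (d : ℕ)
    (x : Fin d → Evec n) :
    cliffLv v (cliffLv w S) d x - cliffRv w (cliffRv v S) d x
      = -2 * repl (S d) v w x + 2 * repl (S d) w v x := by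
  have hc : ⟪w, v⟫ = ⟪v, w⟫ := real_inner_comm _ _
  match d, x with
  | 0, x =>
    have e1 := iota_wedge (hS 0) w v x
    have e2 := iota_wedge (hS 0) v w x
    have e3 := iota_iota (hS 2) v w x
    simp only [cliffLv, cliffRv, iotaV'_add, iotaV'_sub, iotaV'_neg, iotaV'_smul, Pi.neg_apply,
      Pi.sub_apply, Pi.add_apply, Pi.smul_apply, smul_eq_mul]
    rw [e1, e2, e3, hc]
    simp [repl]
  | 1, x =>
    have e1 := iota_wedge (hS 1) w v x
    have e2 := iota_wedge (hS 1) v w x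
    have e3 := iota_iota (hS 3) v w x
    have e4 := wedge_iota (hS 1) w v x
    have e5 := wedge_iota (hS 1) v w x
    simp only [cliffLv, cliffRv, iotaV'_add, iotaV'_sub, iotaV'_neg, iotaV'_smul, Pi.neg_apply,
      Pi.sub_apply, Pi.add_apply, Pi.smul_apply, smul_eq_mul, wedgeC_neg, wedgeC_add, wedgeC_sub,
      wedgeC_smul]
    rw [e1, e2, e3, e4, e5, hc]
    ring
  | d + 2, x =>
    have e1 := iota_wedge (hS (d+2)) w v x
    have e2 := iota_wedge (hS (d+2)) v w x
    have e3 := iota_iota (hS (d+2+2)) v w x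
    have e4 := wedge_iota (hS (d+2)) w v x
    have e5 := wedge_iota (hS (d+2)) v w x
    have e6 := wedge_wedge (S d) (fun u => ⟪v, u⟫) (fun u => ⟪w, u⟫) x
    have hs : ((-1 : ℝ) ^ d) * (-1 : ℝ) ^ d = 1 := by
      rw [← mul_pow]; simp
    simp only [cliffLv, cliffRv, iotaV'_add, iotaV'_sub, iotaV'_neg, iotaV'_smul, Pi.neg_apply,
      Pi.sub_apply, Pi.add_apply, Pi.smul_apply, smul_eq_mul, wedgeC_neg, wedgeC_add, wedgeC_sub,
      wedgeC_smul]
    rw [e1, e2, e3, e4, e5, e6, hc]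
    simp only [pow_succ]
    generalize (-1 : ℝ) ^ d = s at *
    generalize iotaV' w (iotaV' v (S (d+2+2))) x = A at *
    generalize wedgeC (fun u => ⟪w, u⟫) (wedgeC (fun u => ⟪v, u⟫) (S d)) x = B at *
    generalize repl (S (d+2)) v w x = C
    generalize repl (S (d+2)) w v x = D
    generalize ⟪v, w⟫ * S (d+2) x = G
    linear_combination (B + D + (G - C) + A) * hs

/-- The derivation extension. -/
def deriv' {n m : ℕ} (α : Evec n → Evec n → ℝ) (S : Form n m) (x : Fin m → Evec n) : ℝ :=
  ∑ k, S (Function.update x k (∑ j, α (x k) (ebasis n j) • ebasis n j))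

lemma sum_ebasis {n : ℕ} (v : Evec n) : ∑ i, ⟪ebasis n i, v⟫ • ebasis n i = v := by
  have := (EuclideanSpace.basisFun (Fin n) ℝ).sum_repr' v
  simpa [ebasis] using this

lemma altML_update_sum {n m : ℕ} {S : Form n m} (hS : IsAltML S) (x : Fin m → Evec n) (k : Fin m)
    (c : Fin n → ℝ) (u : Fin n → Evec n) :
    S (Function.update x k (∑ j, c j • u j)) = ∑ j, c j * S (Function.update x k (u j)) := by
  obtain ⟨F, rfl⟩ := (altML_iff S).1 hS
  simp [AlternatingMap.map_update_sum, AlternatingMap.map_update_smul]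

lemma deriv'_eq {n m : ℕ} {α : Evec n → Evec n → ℝ} (hα : IsBilin α) {S : Form n m}
    (hS : IsAltML S) (x : Fin m → Evec n) :
    deriv' α S x =
      ∑ i, ∑ j, α (ebasis n i) (ebasis n j) * repl S (ebasis n i) (ebasis n j) x := by
  unfold deriv' repl
  simp only [Finset.mul_sum]
  have : ∀ k j, α (x k) (ebasis n j) = ∑ i, ⟪ebasis n i, x k⟫ * α (ebasis n i) (ebasis n j) := by
    intro k j
    have hl := hα.1 (ebasis n j)
    conv_lhs => rw [← sum_ebasis (x k)]
    have := map_sum (hl.mk' _) (fun i => ⟪ebasis n i, x k⟫ • ebasis n i) Finset.univ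
    have h2 : α (∑ i, ⟪ebasis n i, x k⟫ • ebasis n i) (ebasis n j)
        = ∑ i, α (⟪ebasis n i, x k⟫ • ebasis n i) (ebasis n j) := this
    rw [h2]
    exact Finset.sum_congr rfl fun i _ => hl.map_smul _ _
  simp only [altML_update_sum hS, this, Finset.sum_mul]
  have e : ∀ (f : Fin m → Fin n → Fin n → ℝ),
      ∑ k, ∑ j, ∑ i, f k j i = ∑ i, ∑ j, ∑ k, f k j i := by
    intro f
    rw [Finset.sum_comm]
    rw [Finset.sum_comm (s := (Finset.univ : Finset (Fin n)))
      (t := (Finset.univ : Finset (Fin n)))]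
    refine Finset.sum_congr rfl fun j _ => ?_
    rw [Finset.sum_comm]
  rw [e]
  refine Finset.sum_congr rfl fun i _ => Finset.sum_congr rfl fun j _ =>
    Finset.sum_congr rfl fun k _ => ?_
  ring

lemma alt_neg {n : ℕ} {α : Evec n → Evec n → ℝ} (hα : IsAltBilin α) (x y : Evec n) :
    α y x = - α x y := by
  have h := hα.2 (x + y)
  rw [(hα.1.1 _).map_add, (hα.1.2 _).map_add, (hα.1.2 _).map_add, hα.2, hα.2] at h
  linarith

lemma comm_two {n : ℕ} {α : Evec n → Evec n → ℝ} (hα : IsAltBilin α) (S : MixedForm n)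
    (hS : ∀ d, IsAltML (S d)) (d : ℕ) (x : Fin d → Evec n) :
    (2:ℝ)⁻¹ * ∑ i, ∑ j, α (ebasis n i) (ebasis n j) *
      (cliffLv (ebasis n i) (cliffLv (ebasis n j) S) d x
        - cliffRv (ebasis n j) (cliffRv (ebasis n i) S) d x)
      = -2 * deriv' α (S d) x := by
  simp only [comm_pair S hS]
  rw [deriv'_eq hα.1 (hS d)]
  have h2 : ∑ i, ∑ j, α (ebasis n i) (ebasis n j) * repl (S d) (ebasis n j) (ebasis n i) x
      = - ∑ i, ∑ j, α (ebasis n i) (ebasis n j) * repl (S d) (ebasis n i) (ebasis n j) x := by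
    rw [Finset.sum_comm]
    simp only [← Finset.sum_neg_distrib]
    refine Finset.sum_congr rfl fun i _ => Finset.sum_congr rfl fun j _ => ?_
    rw [alt_neg hα (ebasis n i) (ebasis n j)]
    ring
  have h3 : ∑ i, ∑ j, α (ebasis n i) (ebasis n j) *
      (-2 * repl (S d) (ebasis n i) (ebasis n j) x + 2 * repl (S d) (ebasis n j) (ebasis n i) x)
      = -2 * (∑ i, ∑ j, α (ebasis n i) (ebasis n j) * repl (S d) (ebasis n i) (ebasis n j) x)
       + 2 * ∑ i, ∑ j, α (ebasis n i) (ebasis n j) * repl (S d) (ebasis n j) (ebasis n i) x := by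
    simp only [Finset.mul_sum, ← Finset.sum_add_distrib]
    refine Finset.sum_congr rfl fun i _ => Finset.sum_congr rfl fun j _ => ?_
    ring
  rw [h3, h2]
  ring

/-! Slices -/

lemma sliceLL {n : ℕ} (v : Evec n) (Ω : MixedDF n) (p q : ℕ) (x : Fin p → Evec n)
    (y : Fin q → Evec n) :
    cliffLvL v Ω p q x y = cliffLv v (fun p x => Ω p q x y) p x := by
  cases p <;> rfl

lemma sliceRL {n : ℕ} (v : Evec n) (Ω : MixedDF n) (p q : ℕ) (x : Fin p → Evec n)
    (y : Fin q → Evec n) :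
    cliffRvL v Ω p q x y = cliffRv v (fun p x => Ω p q x y) p x := by
  cases p <;> rfl

lemma sliceLR {n : ℕ} (v : Evec n) (Ω : MixedDF n) (p q : ℕ) (x : Fin p → Evec n)
    (y : Fin q → Evec n) :
    cliffLvR v Ω p q x y = cliffLv v (fun q y => Ω p q x y) q y := by
  cases q <;> rfl

lemma sliceRR {n : ℕ} (v : Evec n) (Ω : MixedDF n) (p q : ℕ) (x : Fin p → Evec n)
    (y : Fin q → Evec n) :
    cliffRvR v Ω p q x y = cliffRv v (fun q y => Ω p q x y) q y := by
  cases q <;> rfl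

lemma adL2_eq {n : ℕ} {α : Evec n → Evec n → ℝ} (hα : IsAltBilin α) (Ω : MixedDF n)
    (p q : ℕ) (x : Fin p → Evec n) (y : Fin q → Evec n)
    (hΩ : ∀ d, IsAltML (fun x => Ω d q x y)) :
    adL2 α Ω p q x y = -2 * deriv' α (fun x => Ω p q x y) x := by
  rw [← comm_two hα (fun p x => Ω p q x y) hΩ p x]
  simp only [adL2, adLpair, Pi.smul_apply, Finset.sum_apply, Pi.sub_apply, smul_eq_mul, sliceLL,
    sliceRL]

lemma adR2_eq {n : ℕ} {α : Evec n → Evec n → ℝ} (hα : IsAltBilin α) (Ω : MixedDF n)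
    (p q : ℕ) (x : Fin p → Evec n) (y : Fin q → Evec n)
    (hΩ : ∀ d, IsAltML (fun y => Ω p d x y)) :
    adR2 α Ω p q x y = -2 * deriv' α (fun y => Ω p q x y) y := by
  rw [← comm_two hα (fun q y => Ω p q x y) hΩ q y]
  simp only [adR2, adRpair, Pi.smul_apply, Finset.sum_apply, Pi.sub_apply, smul_eq_mul, sliceLR,
    sliceRR]

lemma altML_smul {n m : ℕ} {f : Form n m} (hf : IsAltML f) (c : ℝ) :
    IsAltML (fun x => c * f x) := by
  obtain ⟨F, rfl⟩ := (altML_iff f).1 hf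
  exact (altML_iff _).2 ⟨c • F, by funext x; simp⟩

lemma altML_sum {n m : ℕ} {ι : Type*} (s : Finset ι) {f : ι → Form n m}
    (hf : ∀ i, IsAltML (f i)) : IsAltML (fun x => ∑ i ∈ s, f i x) := by
  choose F hF using fun i => (altML_iff (f i)).1 (hf i)
  exact (altML_iff _).2 ⟨∑ i ∈ s, F i, by
    funext x
    simp only [hF]
    induction s using Finset.cons_induction with
    | empty => simp
    | cons a s ha ih => simp [Finset.sum_cons, ih]⟩

lemma altML_deriv {n p q : ℕ} (α : Evec n → Evec n → ℝ) {ω : DF n p q} (hω : IsDF ω)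
    (y : Fin q → Evec n) : IsAltML (fun x => deriv' α (ω x) y) :=
  altML_sum _ fun k => hω.1 _

lemma altML_zero {n m : ℕ} : IsAltML (0 : Form n m) :=
  (altML_iff _).2 ⟨0, by funext x; simp⟩

lemma embDF_isDF {n p q : ℕ} {ω : DF n p q} (hω : IsDF ω) (p' q' : ℕ) :
    IsDF (embDF p q ω p' q') := by
  unfold embDF
  split_ifs with h
  · obtain ⟨rfl, rfl⟩ := h
    exact hω
  · exact ⟨fun _ => altML_zero, fun _ => altML_zero⟩

lemma lhs_eq {n p q : ℕ} {α₁ α₂ : Evec n → Evec n → ℝ}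
    (h₁ : IsAltBilin α₁) (h₂ : IsAltBilin α₂) {ω : DF n p q} (hω : IsDF ω) (p' q' : ℕ)
    (x : Fin p' → Evec n) (y : Fin q' → Evec n) :
    adL2 α₁ (adR2 α₂ (embDF p q ω)) p' q' x y =
      4 * deriv' α₁ (fun x => deriv' α₂ (embDF p q ω p' q' x) y) x := by
  have hR : ∀ d, (fun x => adR2 α₂ (embDF p q ω) d q' x y) =
      fun x => -2 * deriv' α₂ (embDF p q ω d q' x) y := by
    intro d
    funext x
    exact adR2_eq h₂ _ _ _ _ _ fun d' => (embDF_isDF hω _ _).2 x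
  rw [adL2_eq h₁]
  · rw [hR]
    simp only [deriv', Finset.mul_sum]
    refine Finset.sum_congr rfl fun k _ => Finset.sum_congr rfl fun l _ => ?_
    ring
  · intro d
    rw [hR]
    exact altML_smul (altML_deriv α₂ (embDF_isDF hω _ _) y) _

/-! Exterior powers of the metric -/

lemma sum_perm_last {p : ℕ} (ψ : Fin (p + 1) → ℝ) (a : Fin (p + 1)) :
    ∑ σ : Equiv.Perm (Fin (p + 1)), ψ (σ a) = (p.factorial : ℝ) * ∑ k, ψ k := by
  have h1 : ∀ b, ∑ σ : Equiv.Perm (Fin (p + 1)), ψ (σ b)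
      = ∑ σ : Equiv.Perm (Fin (p + 1)), ψ (σ a) := by
    intro b
    rw [← Equiv.sum_comp (Equiv.mulRight (Equiv.swap a b))]
    simp
  have h2 : ∑ b, ∑ σ : Equiv.Perm (Fin (p + 1)), ψ (σ b) = ((p+1).factorial : ℝ) * ∑ k, ψ k := by
    rw [Finset.sum_comm]
    simp only [Equiv.sum_comp]
    simp [Fintype.card_perm]
  simp only [h1] at h2
  rw [Nat.factorial_succ] at h2
  simp at h2
  have h3 : ((p : ℝ) + 1) ≠ 0 := by positivity
  rw [mul_assoc] at h2
  exact mul_left_cancel₀ h3 h2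

lemma altML_snoc {n p : ℕ} {η : Form n (p + 1)} (hη : IsAltML η) (w : Evec n) :
    IsAltML (fun z : Fin p → Evec n => η (Fin.snoc (α := fun _ => Evec n) z w)) := by
  refine ⟨?_, ?_⟩
  · intro x i c a b
    simp only [Fin.snoc_update]
    exact hη.1 _ _ _ _ _
  · intro x i j hij hx
    refine hη.2 _ i.castSucc j.castSucc (by simpa using hij) ?_
    simpa using hx

lemma altML_perm {n m : ℕ} {η : Form n m} (hη : IsAltML η) (x : Fin m → Evec n)
    (σ : Equiv.Perm (Fin m)) :
    η (fun i => x (σ i)) = ((Equiv.Perm.sign σ : ℤ) : ℝ) * η x := by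
  obtain ⟨F, rfl⟩ := (altML_iff η).1 hη
  have := F.map_perm x σ
  rw [Units.smul_def, zsmul_eq_mul] at this
  exact this

lemma sign_sq {m : ℕ} (σ : Equiv.Perm (Fin m)) :
    ((Equiv.Perm.sign σ : ℤ) : ℝ) * ((Equiv.Perm.sign σ : ℤ) : ℝ) = 1 := by
  rcases Int.units_eq_one_or (Equiv.Perm.sign σ) with h | h <;> simp [h]

lemma wedge_pair {n p : ℕ} (G : DF n p p) (c : ℝ)
    (hG : ∀ (η : Form n p), IsAltML η → ∀ x,
      ∑ f : Fin p → Fin n, G x (fun i => ebasis n (f i)) * η (fun i => ebasis n (f i)) = c * η x)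
    (h : Evec n → Evec n → ℝ) (η : Form n (p + 1)) (hη : IsAltML η) (x : Fin (p + 1) → Evec n) :
    ∑ f : Fin (p + 1) → Fin n, wedge G (rho h) x (fun i => ebasis n (f i)) *
        η (fun i => ebasis n (f i)) =
      c * ((p + 1).factorial : ℝ) * ((p.factorial : ℝ))⁻¹ * deriv' h η x := by
  have key : ∀ σ τ : Equiv.Perm (Fin (p + 1)),
      ∑ f : Fin (p + 1) → Fin n, ((Equiv.Perm.sign τ : ℤ) : ℝ) *
        (G (fun i => x (σ (Fin.castAdd 1 i))) (fun j => ebasis n (f (τ (Fin.castAdd 1 j)))) *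
         h (x (σ (Fin.last p))) (ebasis n (f (τ (Fin.last p))))) *
          η (fun i => ebasis n (f i))
      = c * (((Equiv.Perm.sign σ : ℤ) : ℝ) * η (Function.update x (σ (Fin.last p))
          (∑ j, h (x (σ (Fin.last p))) (ebasis n j) • ebasis n j))) := by
    intro σ τ
    have s1 : ∀ f : Fin (p + 1) → Fin n, ((Equiv.Perm.sign τ : ℤ) : ℝ) *
        (G (fun i => x (σ (Fin.castAdd 1 i))) (fun j => ebasis n (f (τ (Fin.castAdd 1 j)))) *
         h (x (σ (Fin.last p))) (ebasis n (f (τ (Fin.last p))))) *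
          η (fun i => ebasis n (f i)) =
        (fun f : Fin (p + 1) → Fin n =>
        (G (fun i => x (σ (Fin.castAdd 1 i))) (fun j => ebasis n (f (Fin.castAdd 1 j))) *
         h (x (σ (Fin.last p))) (ebasis n (f (Fin.last p)))) *
          η (fun i => ebasis n (f i))) (Equiv.arrowCongr τ.symm (Equiv.refl _) f) := by
      intro f
      have := altML_perm hη (fun i => ebasis n (f i)) τ
      simp only [Equiv.arrowCongr_apply, Function.comp_apply, Equiv.symm_symm, Equiv.refl_apply]
      rw [this]
      ring
    rw [Finset.sum_congr rfl fun f _ => s1 f,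
      Equiv.sum_comp (Equiv.arrowCongr τ.symm (Equiv.refl (Fin n)))
        (fun f : Fin (p + 1) → Fin n =>
        (G (fun i => x (σ (Fin.castAdd 1 i))) (fun j => ebasis n (f (Fin.castAdd 1 j))) *
         h (x (σ (Fin.last p))) (ebasis n (f (Fin.last p)))) *
          η (fun i => ebasis n (f i))),
      ← Equiv.sum_comp (Fin.snocEquiv fun _ => Fin n), Fintype.sum_prod_type]
    have s2 : ∀ j : Fin n, ∑ f : Fin p → Fin n,
        (G (fun i => x (σ (Fin.castAdd 1 i))) (fun i => ebasis n
          (Fin.snocEquiv (fun _ => Fin n) (j, f) (Fin.castAdd 1 i))) *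
         h (x (σ (Fin.last p))) (ebasis n (Fin.snocEquiv (fun _ => Fin n) (j, f) (Fin.last p)))) *
          η (fun i => ebasis n (Fin.snocEquiv (fun _ => Fin n) (j, f) i))
        = c * (h (x (σ (Fin.last p))) (ebasis n j) *
            η (Function.update (fun i => x (σ i)) (Fin.last p) (ebasis n j))) := by
      intro j
      have g1 := hG _ (altML_snoc hη (ebasis n j)) (fun i => x (σ (Fin.castAdd 1 i)))
      have g2 : (Fin.snoc (α := fun _ => Evec n) (fun i => x (σ (Fin.castAdd 1 i))) (ebasis n j))
          = Function.update (fun i => x (σ i)) (Fin.last p) (ebasis n j) := by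
        funext i
        refine Fin.lastCases ?_ (fun i => ?_) i
        · simp
        · simp [Fin.castAdd, Fin.castSucc_ne_last]
          rfl
      rw [g2] at g1
      rw [mul_left_comm, ← g1, Finset.mul_sum]
      refine Finset.sum_congr rfl fun f _ => ?_
      have g3 : (fun i => ebasis n (Fin.snocEquiv (fun _ => Fin n) (j, f) i))
          = Fin.snoc (α := fun _ => Evec n) (fun i => ebasis n (f i)) (ebasis n j) := by
        funext i
        refine Fin.lastCases ?_ (fun i => ?_) i <;> simp [Fin.snocEquiv]
      have g4 : ∀ i : Fin p, Fin.snocEquiv (fun _ => Fin n) (j, f) (Fin.castAdd 1 i) = f i := by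
        intro i
        exact Fin.snoc_castSucc (α := fun _ => Fin n) j f i
      have g5 : Fin.snocEquiv (fun _ => Fin n) (j, f) (Fin.last p) = j := by
        simp [Fin.snocEquiv]
      rw [g3, g5]
      simp only [g4]
      ring
    rw [Finset.sum_congr rfl fun j _ => s2 j, ← Finset.mul_sum, ← altML_update_sum hη,
      ← altML_perm hη]
    congr 2
    funext i
    by_cases hi : i = Fin.last p
    · subst hi; simp
    · rw [Function.update_of_ne hi, Function.update_of_ne (fun e => hi (σ.injective e))]
  have expand : ∀ f : Fin (p + 1) → Fin n,
      wedge G (rho h) x (fun i => ebasis n (f i)) * η (fun i => ebasis n (f i))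
      = ((p.factorial : ℝ) * p.factorial)⁻¹ * ∑ σ : Equiv.Perm (Fin (p + 1)),
        ∑ τ : Equiv.Perm (Fin (p + 1)), ((Equiv.Perm.sign σ : ℤ) : ℝ) *
        (((Equiv.Perm.sign τ : ℤ) : ℝ) *
        (G (fun i => x (σ (Fin.castAdd 1 i))) (fun j => ebasis n (f (τ (Fin.castAdd 1 j)))) *
         h (x (σ (Fin.last p))) (ebasis n (f (τ (Fin.last p))))) *
          η (fun i => ebasis n (f i))) := by
    intro f
    have e0 : Fin.natAdd p (0 : Fin 1) = Fin.last p := rfl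
    unfold wedge rho
    rw [mul_assoc]
    congr 1
    · simp
    · rw [Finset.sum_mul]
      refine Finset.sum_congr rfl fun σ _ => ?_
      rw [Finset.sum_mul]
      refine Finset.sum_congr rfl fun τ _ => ?_
      beta_reduce
      rw [e0]
      ring
  rw [Finset.sum_congr rfl fun f _ => expand f, ← Finset.mul_sum, Finset.sum_comm]
  have step : ∀ σ : Equiv.Perm (Fin (p + 1)), ∑ f : Fin (p + 1) → Fin n,
        ∑ τ : Equiv.Perm (Fin (p + 1)), ((Equiv.Perm.sign σ : ℤ) : ℝ) *
        (((Equiv.Perm.sign τ : ℤ) : ℝ) *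
        (G (fun i => x (σ (Fin.castAdd 1 i))) (fun j => ebasis n (f (τ (Fin.castAdd 1 j)))) *
         h (x (σ (Fin.last p))) (ebasis n (f (τ (Fin.last p))))) *
          η (fun i => ebasis n (f i)))
      = ((p + 1).factorial : ℝ) * c * η (Function.update x (σ (Fin.last p))
          (∑ j, h (x (σ (Fin.last p))) (ebasis n j) • ebasis n j)) := by
    intro σ
    rw [Finset.sum_comm]
    simp only [← Finset.mul_sum, key]
    rw [Finset.sum_const, Finset.card_univ, Fintype.card_perm, Fintype.card_fin, nsmul_eq_mul]
    linear_combination (((p + 1).factorial : ℝ) * c * η (Function.update x (σ (Fin.last p))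
          (∑ j, h (x (σ (Fin.last p))) (ebasis n j) • ebasis n j))) * sign_sq σ
  rw [Finset.sum_congr rfl fun σ _ => step σ, ← Finset.mul_sum,
    sum_perm_last (fun k => η (Function.update x k (∑ j, h (x k) (ebasis n j) • ebasis n j)))]
  unfold deriv'
  have h1 : (p.factorial : ℝ) ≠ 0 := by positivity
  field_simp

lemma gpow_pair {n : ℕ} (p : ℕ) (η : Form n p) (hη : IsAltML η) (x : Fin p → Evec n) :
    ∑ f : Fin p → Fin n, gpow n p x (fun i => ebasis n (f i)) * η (fun i => ebasis n (f i))
      = ((p.factorial : ℝ) ^ 2) * η x := by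
  induction p with
  | zero =>
    simp only [gpow, Nat.factorial_zero]
    simp
    congr 1
    exact Subsingleton.elim _ _
  | succ p ih =>
    have := wedge_pair (gpow n p) _ (fun η hη x => ih η hη x) (fun x y => ⟪x, y⟫) η hη x
    have e : wedge (gpow n p) (rho fun x y => ⟪x, y⟫) = gpow n (p + 1) := rfl
    rw [e] at this
    rw [this]
    have e2 : deriv' (fun x y : Evec n => (⟪x, y⟫ : ℝ)) η x = (p + 1) * η x := by
      unfold deriv'
      have : ∀ v : Evec n, ∑ j, (⟪v, ebasis n j⟫ : ℝ) • ebasis n j = v := by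
        intro v
        conv_rhs => rw [← sum_ebasis v]
        simp only [real_inner_comm]
      simp [this]
    rw [e2, Nat.factorial_succ]
    have : (p.factorial : ℝ) ≠ 0 := by positivity
    push_cast
    field_simp

lemma gPowRho_pair {n : ℕ} (p : ℕ) (α : Evec n → Evec n → ℝ) (η : Form n p) (hη : IsAltML η)
    (x : Fin p → Evec n) :
    ((p.factorial : ℝ))⁻¹ * ∑ f : Fin p → Fin n, gPowRho p α x (fun i => ebasis n (f i)) *
      η (fun i => ebasis n (f i)) = deriv' α η x := by
  cases p with
  | zero => simp [gPowRho, deriv']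
  | succ p =>
    have := wedge_pair (gpow n p) _ (fun η hη x => gpow_pair p η hη x) α η hη x
    simp only [gPowRho, Pi.smul_apply, smul_eq_mul, mul_assoc, ← Finset.mul_sum]
    rw [this]
    have h1 : (p.factorial : ℝ) ≠ 0 := by positivity
    have h2 : ((p+1).factorial : ℝ) ≠ 0 := by positivity
    field_simp

lemma wedge_transp {n p q r s : ℕ} (ω : DF n p q) (η : DF n r s) (x : Fin (p + r) → Evec n)
    (y : Fin (q + s) → Evec n) :
    wedge ω η x y = wedge (transp ω) (transp η) y x := by
  unfold wedge transp
  rw [Finset.sum_comm]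
  congr 1
  · congr 2
    ring
  · refine Finset.sum_congr rfl fun σ _ => Finset.sum_congr rfl fun τ _ => ?_
    ring

lemma gpow_transp {n : ℕ} (p : ℕ) : transp (gpow n p) = gpow n p := by
  induction p with
  | zero => rfl
  | succ p ih =>
    funext x y
    have hg : transp (gdf n) = gdf n := by
      funext x y
      exact real_inner_comm _ _
    show wedge (gpow n p) (gdf n) y x = wedge (gpow n p) (gdf n) x y
    rw [wedge_transp, ih, hg]

lemma gPowRho_transp {n : ℕ} (p : ℕ) (α : Evec n → Evec n → ℝ) (x y : Fin p → Evec n) :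
    gPowRho p α x y = gPowRho p (fun u v => α v u) y x := by
  cases p with
  | zero => rfl
  | succ p =>
    simp only [gPowRho, Pi.smul_apply]
    rw [wedge_transp, gpow_transp]
    rfl

lemma deriv'_flip {n m : ℕ} {α : Evec n → Evec n → ℝ} (hα : IsAltBilin α) {S : Form n m}
    (hS : IsAltML S) (x : Fin m → Evec n) :
    deriv' (fun u v => α v u) S x = - deriv' α S x := by
  unfold deriv'
  simp only [altML_update_sum hS, ← Finset.sum_neg_distrib]
  refine Finset.sum_congr rfl fun k _ => Finset.sum_congr rfl fun j _ => ?_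
  rw [alt_neg hα (x k) (ebasis n j)]
  ring

lemma rhs_eq {n p q : ℕ} {α₁ α₂ : Evec n → Evec n → ℝ}
    (h₂ : IsAltBilin α₂) {ω : DF n p q} (hω : IsDF ω)
    (x : Fin p → Evec n) (y : Fin q → Evec n) :
    comp (comp (gPowRho q α₂) ω) (gPowRho p α₁) x y =
      - deriv' α₁ (fun x => deriv' α₂ (ω x) y) x := by
  have hin : ∀ x', comp (gPowRho q α₂) ω x' y = -1 * deriv' α₂ (ω x') y := by
    intro x'
    rw [neg_one_mul, ← deriv'_flip h₂ (hω.2 x'), ← gPowRho_pair q _ _ (hω.2 x')]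
    unfold comp
    congr 1
    refine Finset.sum_congr rfl fun f _ => ?_
    rw [gPowRho_transp, mul_comm]
  have := gPowRho_pair p α₁ _ (altML_smul (altML_deriv α₂ hω y) (-1)) x
  unfold comp at hin ⊢
  simp only [hin]
  rw [this]
  simp only [deriv', ← Finset.sum_neg_distrib, Finset.mul_sum]
  refine Finset.sum_congr rfl fun k _ => Finset.sum_congr rfl fun l _ => ?_
  ring

/-- For a simple `(2,2)` double form `α = α₁⊗α₂` and a `(p,q)` double
form `ω`: `α # ω = −4 (g^{q−1}ρ(α₂)/(q−1)!) ∘ ω ∘ (g^{p−1}ρ(α₁)/(p−1)!)`, with the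
convention `g^{−1} = 0`. -/
theorem statement15 (n p q : ℕ) (α₁ α₂ : Evec n → Evec n → ℝ)
    (h₁ : IsAltBilin α₁) (h₂ : IsAltBilin α₂) (ω : DF n p q) (hω : IsDF ω) :
    adL2 α₁ (adR2 α₂ (embDF p q ω)) =
      embDF p q ((-4 : ℝ) • comp (comp (gPowRho q α₂) ω) (gPowRho p α₁)) := by
  funext p' q' x y
  rw [lhs_eq h₁ h₂ hω]
  by_cases h : p' = p ∧ q' = q
  · obtain ⟨rfl, rfl⟩ := h
    have e : ∀ η : DF n p' q', embDF p' q' η p' q' = η := by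
      intro η
      simp [embDF]
    rw [e, e]
    simp only [Pi.smul_apply, smul_eq_mul]
    rw [rhs_eq h₂ hω]
    ring
  · simp [embDF, h, deriv']
end
end
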